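/- Σₙ-soundness does not imply (n+1)-consistency: for every natural number n there exists a theory S extending Robinson arithmetic Q such that S is Σₙ-sound (indeed S contains Πₙ-Th(ℕ)) but S is not (n+1)-consistent, i.e., there is a formula δ(x) ∈ Πₙ with S ⊢ ∃x δ(x) and S ⊢ ¬δ(k̄) for every k ∈ ℕ. -/

import Mathlib

/-!
Formalization of results from "Gödel–Rosser's Incompleteness Theorems for
non-RE Theories" (Salehi & Seraji).

We work in the first-order language of arithmetic `{0, S, +, ×, ≤}` with the
standard model `ℕ`.  Provability `T ⊢ φ` is rendered as the semantic
consequence `T ⊨ᵇ φ` of Mathlib's model theory library, which by the Gödel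
completeness theorem coincides with provability in first-order logic.
-/

open FirstOrder Language BoundedFormula

namespace GRNonRE

/-- Function symbols of arithmetic: `0`, `S`, `+`, `×`. -/
inductive ArithFunc : ℕ → Type
  | zero : ArithFunc 0
  | succ : ArithFunc 1
  | add  : ArithFunc 2
  | mul  : ArithFunc 2

/-- The relation symbol `≤`. -/
inductive ArithRel : ℕ → Type
  | le : ArithRel 2

/-- The first-order language of arithmetic `{0, S, +, ×, ≤}`. -/
def LA : FirstOrder.Language := ⟨ArithFunc, ArithRel⟩

/-- The standard model `ℕ`. -/
instance : LA.Structure ℕ where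
  funMap {_} f := match f with
    | ArithFunc.zero => fun _ => 0
    | ArithFunc.succ => fun v => v 0 + 1
    | ArithFunc.add  => fun v => v 0 + v 1
    | ArithFunc.mul  => fun v => v 0 * v 1
  RelMap {_} r := match r with
    | ArithRel.le => fun v => v 0 ≤ v 1

def zeroT {α : Type} : LA.Term α := Term.func ArithFunc.zero ![]
def succT {α : Type} (t : LA.Term α) : LA.Term α := Term.func ArithFunc.succ ![t]
def addT {α : Type} (t s : LA.Term α) : LA.Term α := Term.func ArithFunc.add ![t, s]
def mulT {α : Type} (t s : LA.Term α) : LA.Term α := Term.func ArithFunc.mul ![t, s]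

/-- The atomic formula `t ≤ s`. -/
def leF {α : Type} {n : ℕ} (t s : LA.Term (α ⊕ Fin n)) : LA.BoundedFormula α n :=
  BoundedFormula.rel ArithRel.le ![t, s]

/-- The numeral `m̄ = S (S ⋯ (S 0))` representing `m : ℕ`. -/
def numeral : ℕ → LA.Term Empty
  | 0 => zeroT
  | n + 1 => succT (numeral n)

instance : Encodable (Σ n, LA.Functions n) :=
  ⟨fun f => match f with
    | ⟨_, ArithFunc.zero⟩ => 0
    | ⟨_, ArithFunc.succ⟩ => 1
    | ⟨_, ArithFunc.add⟩ => 2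
    | ⟨_, ArithFunc.mul⟩ => 3,
   fun n => match n with
    | 0 => some ⟨0, ArithFunc.zero⟩
    | 1 => some ⟨1, ArithFunc.succ⟩
    | 2 => some ⟨2, ArithFunc.add⟩
    | 3 => some ⟨2, ArithFunc.mul⟩
    | _ => none,
   by rintro ⟨n, f⟩; cases f <;> rfl⟩

instance : Encodable (Σ n, LA.Relations n) :=
  ⟨fun _ => 0,
   fun n => match n with
    | 0 => some ⟨2, ArithRel.le⟩
    | _ => none,
   by rintro ⟨n, r⟩; cases r; rfl⟩

/-- A standard Gödel numbering of formulas, obtained from Mathlib's structural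
encoding of bounded formulas as lists of symbols. -/
def godel {k : ℕ} (φ : LA.BoundedFormula Empty k) : ℕ :=
  Encodable.encode φ.listEncode

/-- Lift a term in context `k` to context `k + 1`. -/
def liftT {k : ℕ} (t : LA.Term (Empty ⊕ Fin k)) : LA.Term (Empty ⊕ Fin (k + 1)) :=
  t.relabel (Sum.map id Fin.castSucc)

/-- The class `Σ₀ = Π₀ = Δ₀` of bounded formulas: built from atomic formulas by
Boolean connectives (`⊥` and `⟹`, from which `∼`, `⊓`, `⊔` are definable) and
bounded universal quantification `∀ x ≤ t, φ` (bounded existential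
quantification `∃ x ≤ t, φ` is expressible as `∼ ∀ x ≤ t, ∼φ`). -/
inductive Delta0 : ∀ {k : ℕ}, LA.BoundedFormula Empty k → Prop
  | falsum {k : ℕ} : Delta0 (⊥ : LA.BoundedFormula Empty k)
  | equal {k : ℕ} (t₁ t₂ : LA.Term (Empty ⊕ Fin k)) : Delta0 (t₁ =' t₂)
  | le {k : ℕ} (t₁ t₂ : LA.Term (Empty ⊕ Fin k)) : Delta0 (leF t₁ t₂)
  | imp {k : ℕ} {φ ψ : LA.BoundedFormula Empty k} :
      Delta0 φ → Delta0 ψ → Delta0 (φ ⟹ ψ)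
  | bdall {k : ℕ} (t : LA.Term (Empty ⊕ Fin k)) {φ : LA.BoundedFormula Empty (k + 1)} :
      Delta0 φ → Delta0 ((leF (&(Fin.last k)) (liftT t) ⟹ φ).all)

mutual
  /-- The classes `Σₙ` of the arithmetical hierarchy: `Σ₀` is the class of
  bounded formulas, and `Σ_{n+1}` contains `Πₙ` and is closed under `⊓`, `⊔`,
  existential quantification and bounded universal quantification. -/
  inductive IsSigma : ℕ → ∀ {k : ℕ}, LA.BoundedFormula Empty k → Prop
    | ofDelta0 {k : ℕ} {φ : LA.BoundedFormula Empty k} : Delta0 φ → IsSigma 0 φ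
    | ofPi {n k : ℕ} {φ : LA.BoundedFormula Empty k} :
        IsPi n φ → IsSigma (n + 1) φ
    | ex {n k : ℕ} {φ : LA.BoundedFormula Empty (k + 1)} :
        IsSigma (n + 1) φ → IsSigma (n + 1) φ.ex
    | inf {n k : ℕ} {φ ψ : LA.BoundedFormula Empty k} :
        IsSigma (n + 1) φ → IsSigma (n + 1) ψ → IsSigma (n + 1) (φ ⊓ ψ)
    | sup {n k : ℕ} {φ ψ : LA.BoundedFormula Empty k} :
        IsSigma (n + 1) φ → IsSigma (n + 1) ψ → IsSigma (n + 1) (φ ⊔ ψ)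
    | bdall {n k : ℕ} (t : LA.Term (Empty ⊕ Fin k))
        {φ : LA.BoundedFormula Empty (k + 1)} :
        IsSigma (n + 1) φ → IsSigma (n + 1) ((leF (&(Fin.last k)) (liftT t) ⟹ φ).all)

  /-- The classes `Πₙ` of the arithmetical hierarchy: `Π₀` is the class of
  bounded formulas, and `Π_{n+1}` contains `Σₙ` and is closed under `⊓`, `⊔`,
  universal quantification and bounded existential quantification. -/
  inductive IsPi : ℕ → ∀ {k : ℕ}, LA.BoundedFormula Empty k → Prop
    | ofDelta0 {k : ℕ} {φ : LA.BoundedFormula Empty k} : Delta0 φ → IsPi 0 φ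
    | ofSigma {n k : ℕ} {φ : LA.BoundedFormula Empty k} :
        IsSigma n φ → IsPi (n + 1) φ
    | all {n k : ℕ} {φ : LA.BoundedFormula Empty (k + 1)} :
        IsPi (n + 1) φ → IsPi (n + 1) φ.all
    | inf {n k : ℕ} {φ ψ : LA.BoundedFormula Empty k} :
        IsPi (n + 1) φ → IsPi (n + 1) ψ → IsPi (n + 1) (φ ⊓ ψ)
    | sup {n k : ℕ} {φ ψ : LA.BoundedFormula Empty k} :
        IsPi (n + 1) φ → IsPi (n + 1) ψ → IsPi (n + 1) (φ ⊔ ψ)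
    | bdex {n k : ℕ} (t : LA.Term (Empty ⊕ Fin k))
        {φ : LA.BoundedFormula Empty (k + 1)} :
        IsPi (n + 1) φ → IsPi (n + 1) ((leF (&(Fin.last k)) (liftT t) ⊓ φ).ex)
end

/-- `T ⊢ φ`: by the Gödel completeness theorem, provability of the sentence `φ`
from the theory `T` coincides with the semantic consequence relation. -/
def Proves (T : LA.Theory) (φ : LA.Sentence) : Prop := T ⊨ᵇ φ

/-- Consistency of a theory. -/
def Consistent (T : LA.Theory) : Prop := ¬ Proves T ⊥

/-- `ψ(m̄)`: the result of substituting the numeral `m̄` for the free variable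
of a formula `ψ(x)` with one free variable. -/
def subst1 (ψ : LA.BoundedFormula Empty 1) (m : ℕ) : LA.Sentence :=
  ψ.toFormula.subst fun _ => numeral m

/-- `n`-consistency: there is no formula `ψ(x) ∈ Π_{n-1}` such that `T ⊢ ¬ψ(m̄)`
for every numeral `m̄` (`m ∈ ℕ`) and yet `T ⊢ ∃x ψ(x)`.
(`0`-consistency is ordinary consistency.) -/
def NCon : ℕ → LA.Theory → Prop
  | 0, T => Consistent T
  | n + 1, T => ¬ ∃ ψ : LA.BoundedFormula Empty 1, IsPi n ψ ∧
      (∀ m : ℕ, Proves T (∼(subst1 ψ m))) ∧ Proves T ψ.ex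

/-- The axioms of Robinson arithmetic `Q`:
`Sx ≠ 0`, `Sx = Sy → x = y`, `x ≠ 0 → ∃y x = Sy`, `x + 0 = x`,
`x + Sy = S(x + y)`, `x·0 = 0`, `x·Sy = x·y + x`, `x ≤ y ↔ ∃z z + x = y`. -/
def QTheory : LA.Theory :=
  { ∀' ∼(succT (&0) =' zeroT),
    ∀' ∀' ((succT (&0) =' succT (&1)) ⟹ (&0 =' &1)),
    ∀' (∼(&0 =' zeroT) ⟹ ∃' (&0 =' succT (&1))),
    ∀' (addT (&0) zeroT =' &0),
    ∀' ∀' (addT (&0) (succT (&1)) =' succT (addT (&0) (&1))),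
    ∀' (mulT (&0) zeroT =' zeroT),
    ∀' ∀' (mulT (&0) (succT (&1)) =' addT (mulT (&0) (&1)) (&0)),
    ((leF (&0) (&1) ⇔ ∃' (addT (&2) (&0) =' (&1)) : LA.BoundedFormula Empty 2)).alls }

/-- `T` is an extension of Robinson arithmetic `Q` (i.e. `T` proves `Q`). -/
def ExtendsQ (T : LA.Theory) : Prop := ∀ φ ∈ QTheory, Proves T φ

/-- `Πₙ-Th(ℕ)`: the set of `Πₙ`-sentences true in the standard model. -/
def PiTh (n : ℕ) : LA.Theory := {φ | IsPi n φ ∧ ℕ ⊨ φ}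

/-- Soundness: every theorem of `T` is true in `ℕ`. -/
def Sound (T : LA.Theory) : Prop := ∀ φ : LA.Sentence, Proves T φ → ℕ ⊨ φ

/-- `Σₙ`-soundness: every `Σₙ`-sentence provable in `T` is true in `ℕ`. -/
def SigmaSound (n : ℕ) (T : LA.Theory) : Prop :=
  ∀ φ : LA.Sentence, IsSigma n φ → Proves T φ → ℕ ⊨ φ

/-- A formula `Ψ(x)` with one free variable defines the set `A ⊆ ℕ` in `ℕ`. -/
def Defines (Ψ : LA.BoundedFormula Empty 1) (A : Set ℕ) : Prop :=
  ∀ m : ℕ, m ∈ A ↔ Ψ.Realize (fun e => Empty.elim e) ![m]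

/-- `A ⊆ ℕ` is definable in `ℕ` by a `Σₙ`-formula. -/
def SigmaDefinable (n : ℕ) (A : Set ℕ) : Prop := ∃ Ψ, IsSigma n Ψ ∧ Defines Ψ A

/-- `A ⊆ ℕ` is definable in `ℕ` by a `Πₙ`-formula. -/
def PiDefinable (n : ℕ) (A : Set ℕ) : Prop := ∃ Ψ, IsPi n Ψ ∧ Defines Ψ A

/-- The set of Gödel numbers of the axioms of `T`. -/
def axiomCodes (T : LA.Theory) : Set ℕ := {m | ∃ φ ∈ T, godel φ = m}

/-- The set of Gödel numbers of the theorems of `T` (its deductive closure). -/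
def theoremCodes (T : LA.Theory) : Set ℕ := {m | ∃ φ, Proves T φ ∧ godel φ = m}

/-- The class of `Σₖ` sets of natural numbers, in the computability-theoretic sense:
`Σ₀` sets are the primitive recursive ones, and `Σₖ₊₁` sets are the projections of complements
of `Σₖ` sets. -/
def SigmaSet : ℕ → (ℕ → Prop) → Prop
  | 0, P => PrimrecPred P
  | k + 1, P => ∃ Q, SigmaSet k Q ∧ ∀ x, P x ↔ ∃ y, ¬ Q (Nat.pair x y)

namespace SigmaSet

variable {k : ℕ} {P Q : ℕ → Prop}

theorem congr (hP : SigmaSet k P) (h : ∀ x, P x ↔ Q x) : SigmaSet k Q :=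
  (funext fun x => propext (h x) : P = Q) ▸ hP

theorem comp (hP : SigmaSet k P) {f : ℕ → ℕ} (hf : Primrec f) : SigmaSet k fun x => P (f x) := by
  induction k generalizing P f with
  | zero => exact PrimrecPred.comp hP hf
  | succ k ih =>
    obtain ⟨Q, hQ, hPQ⟩ := hP
    refine ⟨_, ih hQ (f := fun z => Nat.pair (f z.unpair.1) z.unpair.2) ?_, fun x => ?_⟩
    · exact Primrec₂.natPair.comp (hf.comp (Primrec.fst.comp Primrec.unpair))
        (Primrec.snd.comp Primrec.unpair)
    · simp [hPQ]

theorem not_succ (hP : SigmaSet k P) : SigmaSet (k + 1) fun x => ¬ P x :=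
  ⟨_, hP.comp (Primrec.fst.comp Primrec.unpair), fun x => by simp⟩

theorem succ (hP : SigmaSet k P) : SigmaSet (k + 1) P := by
  induction k generalizing P with
  | zero => exact (not_succ (k := 0) (PrimrecPred.not hP)).congr fun x => not_not
  | succ k ih =>
    obtain ⟨Q, hQ, hPQ⟩ := hP
    exact ⟨Q, ih hQ, hPQ⟩

theorem mono {l : ℕ} (hP : SigmaSet k P) (h : k ≤ l) : SigmaSet l P := by
  induction h with
  | refl => exact hP
  | step _ ih => exact ih.succ

theorem of_primrecPred (hP : PrimrecPred P) : SigmaSet k P :=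
  mono (k := 0) hP (Nat.zero_le k)

theorem and_or (hP : SigmaSet k P) (hQ : SigmaSet k Q) :
    (SigmaSet k fun x => P x ∧ Q x) ∧ SigmaSet k fun x => P x ∨ Q x := by
  induction k generalizing P Q with
  | zero => exact ⟨PrimrecPred.and hP hQ, PrimrecPred.or hP hQ⟩
  | succ k ih =>
    obtain ⟨P', hP', hP⟩ := hP
    obtain ⟨Q', hQ', hQ⟩ := hQ
    have pf : Primrec fun z : ℕ => z.unpair.1 := Primrec.fst.comp Primrec.unpair
    have ps : Primrec fun z : ℕ => z.unpair.2 := Primrec.snd.comp Primrec.unpair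
    constructor
    · refine ⟨_, (ih (hP'.comp (f := fun z => Nat.pair z.unpair.1 z.unpair.2.unpair.1) ?_)
        (hQ'.comp (f := fun z => Nat.pair z.unpair.1 z.unpair.2.unpair.2) ?_)).2, fun x => ?_⟩
      · exact Primrec₂.natPair.comp pf (pf.comp ps)
      · exact Primrec₂.natPair.comp pf (ps.comp ps)
      · simp only [hP, hQ, Nat.unpair_pair, not_or]
        constructor
        · rintro ⟨⟨y, hy⟩, z, hz⟩
          exact ⟨Nat.pair y z, by simpa using ⟨hy, hz⟩⟩
        · rintro ⟨y, hy, hz⟩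
          exact ⟨⟨_, hy⟩, _, hz⟩
    · refine ⟨_, (ih hP' hQ').1, fun x => ?_⟩
      simp only [hP, hQ, ← exists_or, not_and_or]

theorem and (hP : SigmaSet k P) (hQ : SigmaSet k Q) : SigmaSet k fun x => P x ∧ Q x :=
  (and_or hP hQ).1

theorem or (hP : SigmaSet k P) (hQ : SigmaSet k Q) : SigmaSet k fun x => P x ∨ Q x :=
  (and_or hP hQ).2

theorem ex (hP : SigmaSet (k + 1) P) : SigmaSet (k + 1) fun x => ∃ y, P (Nat.pair x y) := by
  obtain ⟨Q, hQ, hPQ⟩ := hP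
  have pf : Primrec fun z : ℕ => z.unpair.1 := Primrec.fst.comp Primrec.unpair
  have ps : Primrec fun z : ℕ => z.unpair.2 := Primrec.snd.comp Primrec.unpair
  refine ⟨_, hQ.comp (f := fun z => Nat.pair (Nat.pair z.unpair.1 z.unpair.2.unpair.1)
    z.unpair.2.unpair.2) ?_, fun x => ?_⟩
  · exact Primrec₂.natPair.comp (Primrec₂.natPair.comp pf (pf.comp ps)) (ps.comp ps)
  · simp only [hPQ, Nat.unpair_pair]
    constructor
    · rintro ⟨y, z, h⟩
      exact ⟨Nat.pair y z, by simpa using h⟩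
    · rintro ⟨y, h⟩
      exact ⟨_, _, h⟩

theorem bex (hP : SigmaSet k P) {f : ℕ → ℕ} (hf : Primrec f) :
    SigmaSet k fun x => ∃ y ≤ f x, P (Nat.pair x y) := by
  cases k with
  | zero =>
    have h : PrimrecRel fun y x => P (Nat.pair x y) :=
      PrimrecPred.comp hP (Primrec₂.natPair.comp Primrec.snd Primrec.fst)
    exact (h.exists_lt.comp (Primrec.succ.comp hf) Primrec.id).of_eq fun x => by
      simp
  | succ k =>
    have h : PrimrecPred fun z : ℕ => z.unpair.2 ≤ f z.unpair.1 :=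
      Primrec.nat_le.comp (Primrec.snd.comp Primrec.unpair)
        (hf.comp (Primrec.fst.comp Primrec.unpair))
    exact (((of_primrecPred h).and hP).ex).congr fun x => by simp

theorem ball (hP : SigmaSet (k + 1) P) {f : ℕ → ℕ} (hf : Primrec f) :
    SigmaSet (k + 1) fun x => ∀ y ≤ f x, P (Nat.pair x y) := by
  obtain ⟨Q, hQ, hPQ⟩ := hP
  have pf : Primrec fun z : ℕ => z.unpair.1 := Primrec.fst.comp Primrec.unpair
  have ps : Primrec fun z : ℕ => z.unpair.2 := Primrec.snd.comp Primrec.unpair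
  have hg : Primrec fun z : ℕ => Nat.pair (Nat.pair z.unpair.1.unpair.1 z.unpair.2)
      ((Denumerable.ofNat (List ℕ) z.unpair.1.unpair.2).getD z.unpair.2 0) :=
    Primrec₂.natPair.comp (Primrec₂.natPair.comp (pf.comp pf) ps)
      ((Primrec.list_getD 0).comp ((Primrec.ofNat (List ℕ)).comp (ps.comp pf)) ps)
  refine ⟨_, (hQ.comp hg).bex (f := fun z => f z.unpair.1) (hf.comp pf), fun x => ?_⟩
  simp only [hPQ, Nat.unpair_pair, not_exists, not_and]
  constructor
  · intro h
    choose! g hg using h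
    refine ⟨Encodable.encode ((List.range (f x + 1)).map g), fun y hy => ?_⟩
    have := hg y hy
    simpa [List.getD_eq_getElem?_getD, List.getElem?_range, Nat.lt_succ_iff.2 hy] using this
  · rintro ⟨w, hw⟩ y hy
    exact ⟨_, hw y hy⟩

end SigmaSet

/-- The value of a term in the standard model. -/
abbrev tval {m : ℕ} (t : LA.Term (Empty ⊕ Fin m)) (v : Fin m → ℕ) : ℕ :=
  t.realize (Sum.elim default v)

section Realize

variable {M : Type} [LA.Structure M] {m : ℕ}

theorem realize_liftT (t : LA.Term (Empty ⊕ Fin m)) (v : Fin m → M) (y : M) (e : Empty → M) :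
    (liftT t).realize (Sum.elim e (Fin.snoc v y : Fin (m + 1) → M)) =
      t.realize (Sum.elim e v) := by
  rw [liftT, Term.realize_relabel]
  congr 1
  funext i
  rcases i with i | i
  · exact i.elim
  · simp

theorem realize_leF_nat (t s : LA.Term (Empty ⊕ Fin m)) (v : Fin m → ℕ) :
    (leF t s).Realize default v ↔ tval t v ≤ tval s v := Iff.rfl

theorem realize_bdall_nat (t : LA.Term (Empty ⊕ Fin m)) (φ : LA.BoundedFormula Empty (m + 1))
    (v : Fin m → ℕ) :
    ((leF (&(Fin.last m)) (liftT t) ⟹ φ).all).Realize default v ↔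
      ∀ y ≤ tval t v, φ.Realize default (Fin.snoc v y : Fin (m + 1) → ℕ) := by
  simp only [realize_all, realize_imp, realize_leF_nat, tval, realize_liftT]
  simp

theorem realize_bdex_nat (t : LA.Term (Empty ⊕ Fin m)) (φ : LA.BoundedFormula Empty (m + 1))
    (v : Fin m → ℕ) :
    ((leF (&(Fin.last m)) (liftT t) ⊓ φ).ex).Realize default v ↔
      ∃ y ≤ tval t v, φ.Realize default (Fin.snoc v y : Fin (m + 1) → ℕ) := by
  simp only [realize_ex, realize_inf, realize_leF_nat, tval, realize_liftT]
  simp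

end Realize

/-- Decoding of a natural number as an `m`-tuple by iterated unpairing. -/
def decodeTuple : ∀ m : ℕ, ℕ → Fin m → ℕ
  | 0, _ => Fin.elim0
  | m + 1, x => Fin.snoc (decodeTuple m x.unpair.1) x.unpair.2

/-- Coding of an `m`-tuple as a natural number by iterated pairing. -/
def encodeTuple : ∀ m : ℕ, (Fin m → ℕ) → ℕ
  | 0, _ => 0
  | m + 1, v => Nat.pair (encodeTuple m fun i => v i.castSucc) (v (Fin.last m))

theorem decodeTuple_pair (m x y : ℕ) :
    decodeTuple (m + 1) (Nat.pair x y) = Fin.snoc (decodeTuple m x) y := by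
  simp [decodeTuple]

theorem decodeTuple_encodeTuple (m : ℕ) (v : Fin m → ℕ) :
    decodeTuple m (encodeTuple m v) = v := by
  induction m with
  | zero => exact Subsingleton.elim _ _
  | succ m ih =>
    rw [encodeTuple, decodeTuple_pair, ih]
    exact Fin.snoc_init_self v

theorem primrec_decodeTuple (m : ℕ) (i : Fin m) : Primrec fun x => decodeTuple m x i := by
  induction m with
  | zero => exact i.elim0
  | succ m ih =>
    refine Fin.lastCases ?_ (fun i => ?_) i
    · simpa [decodeTuple] using Primrec.snd.comp Primrec.unpair
    · simpa [decodeTuple] using (ih i).comp (Primrec.fst.comp Primrec.unpair)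

theorem primrec_tval {m : ℕ} (t : LA.Term (Empty ⊕ Fin m)) :
    Primrec fun x => tval t (decodeTuple m x) := by
  induction t with
  | var i =>
    rcases i with i | i
    · exact i.elim
    · exact primrec_decodeTuple m i
  | func f ts ih =>
    cases f with
    | zero => exact Primrec.const 0
    | succ => exact Primrec.succ.comp (ih 0)
    | add => exact Primrec.nat_add.comp (ih 0) (ih 1)
    | mul => exact Primrec.nat_mul.comp (ih 0) (ih 1)

theorem Delta0.primrecPred {m : ℕ} {φ : LA.BoundedFormula Empty m} (h : Delta0 φ) :
    PrimrecPred fun x => φ.Realize default (decodeTuple m x) := by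
  induction h with
  | falsum =>
    exact PrimrecPred.of_eq (p := fun _ => False) ⟨inferInstance, Primrec.const _⟩ (by simp)
  | equal t₁ t₂ => exact Primrec.eq.comp (primrec_tval t₁) (primrec_tval t₂)
  | le t₁ t₂ => exact Primrec.nat_le.comp (primrec_tval t₁) (primrec_tval t₂)
  | imp _ _ ih₁ ih₂ =>
    exact (ih₁.not.or ih₂).of_eq fun x => by rw [realize_imp, imp_iff_not_or]
  | bdall t _ ih =>
    refine PrimrecPred.of_eq (PrimrecPred.not
      (SigmaSet.bex (k := 0) (PrimrecPred.not ih) (primrec_tval t))) fun x => ?_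
    rw [realize_bdall_nat]
    simp [decodeTuple_pair]

/-- Simultaneous induction on the classes `Σₙ` and `Πₙ`. -/
theorem hierarchy_induction {S P : ∀ (_ m : ℕ), LA.BoundedFormula Empty m → Prop}
    (sigma_ofDelta0 : ∀ {m : ℕ} {φ : LA.BoundedFormula Empty m}, Delta0 φ → S 0 m φ)
    (sigma_ofPi : ∀ {n m : ℕ} {φ : LA.BoundedFormula Empty m}, IsPi n φ → P n m φ → S (n + 1) m φ)
    (sigma_ex : ∀ {n m : ℕ} {φ : LA.BoundedFormula Empty (m + 1)}, IsSigma (n + 1) φ →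
      S (n + 1) (m + 1) φ → S (n + 1) m φ.ex)
    (sigma_inf : ∀ {n m : ℕ} {φ ψ : LA.BoundedFormula Empty m}, S (n + 1) m φ →
      S (n + 1) m ψ → S (n + 1) m (φ ⊓ ψ))
    (sigma_sup : ∀ {n m : ℕ} {φ ψ : LA.BoundedFormula Empty m}, S (n + 1) m φ →
      S (n + 1) m ψ → S (n + 1) m (φ ⊔ ψ))
    (sigma_bdall : ∀ {n m : ℕ} (t : LA.Term (Empty ⊕ Fin m))
      {φ : LA.BoundedFormula Empty (m + 1)}, S (n + 1) (m + 1) φ →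
      S (n + 1) m (leF (&(Fin.last m)) (liftT t) ⟹ φ).all)
    (pi_ofDelta0 : ∀ {m : ℕ} {φ : LA.BoundedFormula Empty m}, Delta0 φ → P 0 m φ)
    (pi_ofSigma : ∀ {n m : ℕ} {φ : LA.BoundedFormula Empty m}, IsSigma n φ → S n m φ →
      P (n + 1) m φ)
    (pi_all : ∀ {n m : ℕ} {φ : LA.BoundedFormula Empty (m + 1)}, IsPi (n + 1) φ →
      P (n + 1) (m + 1) φ → P (n + 1) m φ.all)
    (pi_inf : ∀ {n m : ℕ} {φ ψ : LA.BoundedFormula Empty m}, P (n + 1) m φ →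
      P (n + 1) m ψ → P (n + 1) m (φ ⊓ ψ))
    (pi_sup : ∀ {n m : ℕ} {φ ψ : LA.BoundedFormula Empty m}, P (n + 1) m φ →
      P (n + 1) m ψ → P (n + 1) m (φ ⊔ ψ))
    (pi_bdex : ∀ {n m : ℕ} (t : LA.Term (Empty ⊕ Fin m))
      {φ : LA.BoundedFormula Empty (m + 1)}, P (n + 1) (m + 1) φ →
      P (n + 1) m (leF (&(Fin.last m)) (liftT t) ⊓ φ).ex) :
    (∀ {n m : ℕ} {φ : LA.BoundedFormula Empty m}, IsSigma n φ → S n m φ) ∧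
    (∀ {n m : ℕ} {φ : LA.BoundedFormula Empty m}, IsPi n φ → P n m φ) :=
  ⟨fun h => IsSigma.rec (motive_1 := fun n m φ _ => S n m φ) (motive_2 := fun n m φ _ => P n m φ)
      sigma_ofDelta0 sigma_ofPi sigma_ex (fun _ _ => sigma_inf) (fun _ _ => sigma_sup)
      (fun t _ _ => sigma_bdall t) pi_ofDelta0 pi_ofSigma pi_all (fun _ _ => pi_inf)
      (fun _ _ => pi_sup) (fun t _ _ => pi_bdex t) h,
    fun h => IsPi.rec (motive_1 := fun n m φ _ => S n m φ) (motive_2 := fun n m φ _ => P n m φ)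
      sigma_ofDelta0 sigma_ofPi sigma_ex (fun _ _ => sigma_inf) (fun _ _ => sigma_sup)
      (fun t _ _ => sigma_bdall t) pi_ofDelta0 pi_ofSigma pi_all (fun _ _ => pi_inf)
      (fun _ _ => pi_sup) (fun t _ _ => pi_bdex t) h⟩

theorem sigmaSet_of_isSigma_isPi :
    (∀ {n m : ℕ} {φ : LA.BoundedFormula Empty m}, IsSigma n φ →
      SigmaSet n fun x => φ.Realize default (decodeTuple m x)) ∧
    (∀ {n m : ℕ} {φ : LA.BoundedFormula Empty m}, IsPi n φ →
      SigmaSet n fun x => ¬ φ.Realize default (decodeTuple m x)) := by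
  refine hierarchy_induction
    (S := fun n m φ => SigmaSet n fun x => φ.Realize default (decodeTuple m x))
    (P := fun n m φ => SigmaSet n fun x => ¬ φ.Realize default (decodeTuple m x))
    ?_ ?_ ?_ ?_ ?_ ?_ ?_ ?_ ?_ ?_ ?_ ?_
  · exact fun h => h.primrecPred
  · exact fun _ ih => ih.not_succ.congr fun x => not_not
  · exact fun _ ih => ih.ex.congr fun x => by simp [decodeTuple_pair]
  · exact fun ih₁ ih₂ => (ih₁.and ih₂).congr fun x => by simp
  · exact fun ih₁ ih₂ => (ih₁.or ih₂).congr fun x => by simp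
  · exact fun t _ ih => (ih.ball (primrec_tval t)).congr fun x => by
      rw [realize_bdall_nat]; simp [decodeTuple_pair]
  · exact fun h => h.primrecPred.not
  · exact fun _ ih => ih.not_succ
  · exact fun _ ih => ih.ex.congr fun x => by simp [decodeTuple_pair]
  · exact fun ih₁ ih₂ => (ih₁.or ih₂).congr fun x => by rw [realize_inf, not_and_or]
  · exact fun ih₁ ih₂ => (ih₁.and ih₂).congr fun x => by rw [realize_sup, not_or]
  · exact fun t _ ih => (ih.ball (primrec_tval t)).congr fun x => by
      rw [realize_bdex_nat]; simp [decodeTuple_pair]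

/-- The negation of a `Σₙ`-formula is equivalent in `ℕ` to a `Πₙ`-formula, and vice versa. -/
theorem exists_neg :
    (∀ {n m : ℕ} {φ : LA.BoundedFormula Empty m}, IsSigma n φ →
      ∃ ψ : LA.BoundedFormula Empty m, IsPi n ψ ∧
        ∀ v : Fin m → ℕ, ψ.Realize default v ↔ ¬ φ.Realize default v) ∧
    (∀ {n m : ℕ} {φ : LA.BoundedFormula Empty m}, IsPi n φ →
      ∃ ψ : LA.BoundedFormula Empty m, IsSigma n ψ ∧
        ∀ v : Fin m → ℕ, ψ.Realize default v ↔ ¬ φ.Realize default v) := by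
  refine hierarchy_induction
    (S := fun n m φ => ∃ ψ : LA.BoundedFormula Empty m, IsPi n ψ ∧
      ∀ v : Fin m → ℕ, ψ.Realize default v ↔ ¬ φ.Realize default v)
    (P := fun n m φ => ∃ ψ : LA.BoundedFormula Empty m, IsSigma n ψ ∧
      ∀ v : Fin m → ℕ, ψ.Realize default v ↔ ¬ φ.Realize default v)
    ?_ ?_ ?_ ?_ ?_ ?_ ?_ ?_ ?_ ?_ ?_ ?_
  · exact fun h => ⟨_, .ofDelta0 (.imp h .falsum), fun v => Iff.rfl⟩
  · exact fun _ ⟨ψ, h, hψ⟩ => ⟨ψ, .ofSigma h, hψ⟩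
  · exact fun _ ⟨ψ, h, hψ⟩ => ⟨_, .all h, fun v => by simp [hψ, -Pi.default_def]⟩
  · exact fun ⟨ψ₁, h₁, hψ₁⟩ ⟨ψ₂, h₂, hψ₂⟩ => ⟨_, .sup h₁ h₂, fun v => by
      rw [realize_sup, realize_inf, hψ₁, hψ₂, not_and_or]⟩
  · exact fun ⟨ψ₁, h₁, hψ₁⟩ ⟨ψ₂, h₂, hψ₂⟩ => ⟨_, .inf h₁ h₂, fun v => by
      rw [realize_sup, realize_inf, hψ₁, hψ₂, not_or]⟩
  · exact fun t _ ⟨ψ, h, hψ⟩ => ⟨_, .bdex t h, fun v => by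
      rw [realize_bdall_nat, realize_bdex_nat]; simp [hψ, -Pi.default_def]⟩
  · exact fun h => ⟨_, .ofDelta0 (.imp h .falsum), fun v => Iff.rfl⟩
  · exact fun _ ⟨ψ, h, hψ⟩ => ⟨ψ, .ofPi h, hψ⟩
  · exact fun _ ⟨ψ, h, hψ⟩ => ⟨_, .ex h, fun v => by simp [hψ, -Pi.default_def]⟩
  · exact fun ⟨ψ₁, h₁, hψ₁⟩ ⟨ψ₂, h₂, hψ₂⟩ => ⟨_, .sup h₁ h₂, fun v => by
      rw [realize_sup, realize_inf, hψ₁, hψ₂, not_and_or]⟩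
  · exact fun ⟨ψ₁, h₁, hψ₁⟩ ⟨ψ₂, h₂, hψ₂⟩ => ⟨_, .inf h₁ h₂, fun v => by
      rw [realize_sup, realize_inf, hψ₁, hψ₂, not_or]⟩
  · exact fun t _ ⟨ψ, h, hψ⟩ => ⟨_, .bdall t h, fun v => by
      rw [realize_bdall_nat, realize_bdex_nat]; simp [hψ, -Pi.default_def]⟩

/-- A function on tuples which is the value of a term. -/
def TermFun {m : ℕ} (f : (Fin m → ℕ) → ℕ) : Prop :=
  ∃ t : LA.Term (Empty ⊕ Fin m), ∀ v, tval t v = f v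

namespace TermFun

variable {m : ℕ} {f g : (Fin m → ℕ) → ℕ}

theorem var (i : Fin m) : TermFun fun v => v i := ⟨Term.var (Sum.inr i), fun _ => rfl⟩

theorem zero : TermFun fun _ : Fin m → ℕ => 0 := ⟨zeroT, fun _ => rfl⟩

theorem succ (hf : TermFun f) : TermFun fun v => f v + 1 :=
  let ⟨t, ht⟩ := hf
  ⟨succT t, fun v => congrArg (· + 1) (ht v)⟩

theorem add (hf : TermFun f) (hg : TermFun g) : TermFun fun v => f v + g v :=
  let ⟨t, ht⟩ := hf
  let ⟨s, hs⟩ := hg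
  ⟨addT t s, fun v => congrArg₂ (· + ·) (ht v) (hs v)⟩

theorem mul (hf : TermFun f) (hg : TermFun g) : TermFun fun v => f v * g v :=
  let ⟨t, ht⟩ := hf
  let ⟨s, hs⟩ := hg
  ⟨mulT t s, fun v => congrArg₂ (· * ·) (ht v) (hs v)⟩

theorem init (hf : TermFun f) : TermFun fun w : Fin (m + 1) → ℕ => f (Fin.init w) := by
  obtain ⟨t, ht⟩ := hf
  refine ⟨liftT t, fun w => ?_⟩
  change _ = f (Fin.init w)
  rw [← ht, tval, tval, ← realize_liftT t (Fin.init w) (w (Fin.last m)), Fin.snoc_init_self]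

theorem last : TermFun fun w : Fin (m + 1) → ℕ => w (Fin.last m) := var _

end TermFun

/-- Relations on tuples defined in `ℕ` by a `Σₖ`-formula. -/
def SigmaRel (k : ℕ) {m : ℕ} (R : (Fin m → ℕ) → Prop) : Prop :=
  ∃ φ : LA.BoundedFormula Empty m, IsSigma k φ ∧ ∀ v, φ.Realize default v ↔ R v

theorem Delta0.isSigma_isPi {m : ℕ} {φ : LA.BoundedFormula Empty m} (h : Delta0 φ) (k : ℕ) :
    IsSigma k φ ∧ IsPi k φ := by
  induction k with
  | zero => exact ⟨.ofDelta0 h, .ofDelta0 h⟩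
  | succ k ih => exact ⟨.ofPi ih.2, .ofSigma ih.1⟩

namespace SigmaRel

variable {k m : ℕ} {R R' : (Fin m → ℕ) → Prop} {f g h : (Fin m → ℕ) → ℕ}

theorem congr (hR : SigmaRel k R) (e : ∀ v, R v ↔ R' v) : SigmaRel k R' :=
  let ⟨φ, hφ, H⟩ := hR
  ⟨φ, hφ, fun v => (H v).trans (e v)⟩

theorem eq (hf : TermFun f) (hg : TermFun g) : SigmaRel k fun v => f v = g v := by
  obtain ⟨t, ht⟩ := hf
  obtain ⟨s, hs⟩ := hg
  refine ⟨t =' s, ((Delta0.equal t s).isSigma_isPi k).1, fun v => ?_⟩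
  change tval t v = tval s v ↔ f v = g v
  rw [ht, hs]

theorem le (hf : TermFun f) (hg : TermFun g) : SigmaRel k fun v => f v ≤ g v := by
  obtain ⟨t, ht⟩ := hf
  obtain ⟨s, hs⟩ := hg
  refine ⟨leF t s, ((Delta0.le t s).isSigma_isPi k).1, fun v => ?_⟩
  change tval t v ≤ tval s v ↔ f v ≤ g v
  rw [ht, hs]

theorem and (hR : SigmaRel (k + 1) R) (hR' : SigmaRel (k + 1) R') :
    SigmaRel (k + 1) fun v => R v ∧ R' v :=
  let ⟨φ, hφ, H⟩ := hR
  let ⟨ψ, hψ, H'⟩ := hR'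
  ⟨φ ⊓ ψ, .inf hφ hψ, fun v => by rw [realize_inf, H, H']⟩

theorem or (hR : SigmaRel (k + 1) R) (hR' : SigmaRel (k + 1) R') :
    SigmaRel (k + 1) fun v => R v ∨ R' v :=
  let ⟨φ, hφ, H⟩ := hR
  let ⟨ψ, hψ, H'⟩ := hR'
  ⟨φ ⊔ ψ, .sup hφ hψ, fun v => by rw [realize_sup, H, H']⟩

theorem not (hR : SigmaRel k R) : SigmaRel (k + 1) fun v => ¬ R v :=
  let ⟨_, hφ, H⟩ := hR
  let ⟨ψ, hψ, H'⟩ := exists_neg.1 hφ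
  ⟨ψ, .ofPi hψ, fun v => by rw [H', H]⟩

theorem ex {R : (Fin m → ℕ) → ℕ → Prop}
    (hR : SigmaRel (k + 1) fun w : Fin (m + 1) → ℕ => R (Fin.init w) (w (Fin.last m))) :
    SigmaRel (k + 1) fun v => ∃ y, R v y :=
  let ⟨φ, hφ, H⟩ := hR
  ⟨φ.ex, .ex hφ, fun v => by simp [H, -Pi.default_def]⟩

theorem ball {R : (Fin m → ℕ) → ℕ → Prop} (hf : TermFun f)
    (hR : SigmaRel (k + 1) fun w : Fin (m + 1) → ℕ => R (Fin.init w) (w (Fin.last m))) :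
    SigmaRel (k + 1) fun v => ∀ y ≤ f v, R v y :=
  let ⟨φ, hφ, H⟩ := hR
  let ⟨t, ht⟩ := hf
  ⟨_, .bdall t hφ, fun v => by rw [realize_bdall_nat]; simp [H, ht, -Pi.default_def]⟩

theorem pair_eq (hf : TermFun f) (hg : TermFun g) (hh : TermFun h) :
    SigmaRel (k + 1) fun v => Nat.pair (f v) (g v) = h v := by
  refine ((and (le hf.succ hg) (eq ((hg.mul hg).add hf) hh)).or
    (and (le hg hf) (eq (((hf.mul hf).add hf).add hg) hh))).congr fun v => ?_
  unfold Nat.pair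
  split_ifs <;> grind

theorem beta_eq (hf : TermFun f) (hg : TermFun g) (hh : TermFun h) :
    SigmaRel (k + 1) fun v => Nat.beta (f v) (g v) = h v := by
  have key : ∀ s i r, (∃ p q, Nat.pair p q = s ∧
      ∃ d, p = d * ((i + 1) * q + 1) + r ∧ r ≤ (i + 1) * q) ↔ Nat.beta s i = r := by
    intro s i r
    constructor
    · rintro ⟨p, q, rfl, d, rfl, hr⟩
      simp only [Nat.beta, Nat.unpair_pair]
      rw [Nat.mul_add_mod_self_right]
      exact Nat.mod_eq_of_lt (Nat.lt_succ_of_le hr)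
    · rintro rfl
      refine ⟨s.unpair.1, s.unpair.2, Nat.pair_unpair s,
        s.unpair.1 / ((i + 1) * s.unpair.2 + 1), ?_, ?_⟩
      · exact (Nat.div_add_mod' _ _).symm
      · exact Nat.le_of_lt_succ (Nat.mod_lt _ (Nat.succ_pos _))
  refine SigmaRel.congr (R := fun v => ∃ p q, Nat.pair p q = f v ∧
      ∃ d, p = d * ((g v + 1) * q + 1) + h v ∧ h v ≤ (g v + 1) * q) ?_ fun v => key _ _ _
  refine ex (ex (and (pair_eq TermFun.last.init .last hf.init.init) (ex (and ?_ ?_))))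
  · exact eq TermFun.last.init.init ((TermFun.last.mul
      ((hg.init.init.init.succ.mul TermFun.last.init).succ)).add hh.init.init.init)
  · exact le hh.init.init.init (hg.init.init.init.succ.mul TermFun.last.init)

end SigmaRel

theorem exists_beta_eq (H : ℕ → ℕ) (n : ℕ) : ∃ s, ∀ j ≤ n, Nat.beta s j = H j := by
  refine ⟨Nat.unbeta (List.ofFn fun i : Fin (n + 1) => H i), fun j hj => ?_⟩
  have := Nat.beta_unbeta_coe (List.ofFn fun i : Fin (n + 1) => H i)
    ⟨j, by simp only [List.length_ofFn]; lia⟩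
  simpa only [List.getElem_ofFn, Fin.getElem_fin] using this

theorem sigmaRel_primrec_eq {F : ℕ → ℕ} (hF : Nat.Primrec F) :
    ∀ {m : ℕ} {f g : (Fin m → ℕ) → ℕ}, TermFun f → TermFun g →
      SigmaRel 1 fun v => F (f v) = g v := by
  induction hF with
  | zero => exact fun _ hg => .eq .zero hg
  | succ => exact fun hf hg => .eq hf.succ hg
  | left =>
    intro m f g hf hg
    refine (SigmaRel.ex (R := fun v y => Nat.pair (g v) y = f v)
      (.pair_eq hg.init .last hf.init)).congr fun v =>
      ⟨fun ⟨y, hy⟩ => by simp [← hy], fun h => ⟨(f v).unpair.2, by simp [← h]⟩⟩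
  | right =>
    intro m f g hf hg
    refine (SigmaRel.ex (R := fun v y => Nat.pair y (g v) = f v)
      (.pair_eq .last hg.init hf.init)).congr fun v =>
      ⟨fun ⟨y, hy⟩ => by simp [← hy], fun h => ⟨(f v).unpair.1, by simp [← h]⟩⟩
  | @pair F G _ _ ihF ihG =>
    intro m f g hf hg
    refine (SigmaRel.ex (R := fun v x => ∃ y, F (f v) = x ∧ G (f v) = y ∧ Nat.pair x y = g v)
      (.ex (.and (ihF hf.init.init TermFun.last.init) (.and (ihG hf.init.init .last)
        (.pair_eq TermFun.last.init .last hg.init.init))))).congr fun v => ?_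
    simp
  | @comp F G _ _ ihF ihG =>
    intro m f g hf hg
    refine (SigmaRel.ex (R := fun v x => G (f v) = x ∧ F x = g v)
      (.and (ihG hf.init .last) (ihF .last hg.init))).congr fun v => ?_
    simp
  | @prec F G _ _ ihF ihG =>
    intro m f g hf hg
    have key : ∀ a b, (∃ z n, Nat.pair z n = a ∧ ∃ s,
        ((∃ u, F z = u ∧ Nat.beta s 0 = u) ∧ (∀ y ≤ n, ∃ u, Nat.beta s y = u ∧
          ∃ p, Nat.pair y u = p ∧ ∃ q, Nat.pair z p = q ∧ ∃ w, G q = w ∧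
            Nat.beta s (y + 1) = w)) ∧ Nat.beta s n = b) ↔
        Nat.unpaired (fun z n => Nat.rec (motive := fun _ => ℕ) (F z)
          (fun y IH => G (Nat.pair z (Nat.pair y IH))) n) a = b := by
      intro a b
      constructor
      · rintro ⟨z, n, rfl, s, ⟨⟨_, rfl, h0⟩, hs⟩, rfl⟩
        simp only [exists_eq_left', Nat.unpaired, Nat.unpair_pair] at hs ⊢
        have : ∀ j ≤ n, Nat.rec (motive := fun _ => ℕ) (F z)
          (fun y IH => G (Nat.pair z (Nat.pair y IH))) j = Nat.beta s j := by
          intro j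
          induction j with
          | zero => exact fun _ => h0.symm
          | succ j ih =>
            intro hj
            rw [hs j (by lia), ← ih (by lia)]
        exact this n le_rfl
      · rintro rfl
        set z := a.unpair.1
        set n := a.unpair.2
        set H : ℕ → ℕ := fun j => Nat.rec (motive := fun _ => ℕ) (F z)
          (fun y IH => G (Nat.pair z (Nat.pair y IH))) j
        obtain ⟨s, hb⟩ := exists_beta_eq H (n + 1)
        refine ⟨z, n, Nat.pair_unpair a, s,
          ⟨⟨_, rfl, hb 0 (by lia)⟩, fun y hy => ?_⟩, hb n (by lia)⟩
        simp only [exists_eq_left']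
        rw [hb y (by lia), hb (y + 1) (by lia)]
    refine SigmaRel.congr ?_ fun v => key (f v) (g v)
    refine .ex (.ex (.and (.pair_eq TermFun.last.init .last hf.init.init)
      (.ex (.and (.and (.ex (.and (ihF TermFun.last.init.init.init .last)
        (.beta_eq TermFun.last.init .zero .last))) (.ball TermFun.last.init ?_))
        (.beta_eq .last TermFun.last.init hg.init.init.init)))))
    refine .ex (.and (.beta_eq TermFun.last.init.init TermFun.last.init .last)
      (.ex (.and (.pair_eq TermFun.last.init.init TermFun.last.init .last)
      (.ex (.and (.pair_eq TermFun.last.init.init.init.init.init.init TermFun.last.init .last)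
      (.ex (.and (ihG TermFun.last.init .last) (.beta_eq TermFun.last.init.init.init.init.init
        TermFun.last.init.init.init.init.succ .last))))))))

theorem SigmaSet.sigmaRel {k : ℕ} {P : ℕ → Prop} (hP : SigmaSet (k + 1) P) :
    ∀ {m : ℕ} {f : (Fin m → ℕ) → ℕ}, TermFun f → SigmaRel (k + 1) fun v => P (f v) := by
  induction k generalizing P with
  | zero =>
    obtain ⟨Q, hQ, hPQ⟩ := hP
    intro m f hf
    obtain ⟨_, hQ⟩ : PrimrecPred Q := hQ
    refine (SigmaRel.ex (R := fun v y => ∃ z, Nat.pair (f v) y = z ∧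
        (Encodable.encode (decide (Q z))) = 0) (.ex (.and
        (.pair_eq hf.init.init TermFun.last.init .last)
        (sigmaRel_primrec_eq (Primrec.nat_iff.1 (Primrec.encode.comp hQ))
          .last .zero)))).congr fun v => ?_
    have hb : ∀ b : Bool, Encodable.encode b = 0 ↔ b = false := by decide
    simp [hPQ, hb]
  | succ k ih =>
    obtain ⟨Q, hQ, hPQ⟩ := hP
    intro m f hf
    refine (SigmaRel.ex (R := fun v y => ∃ z, Nat.pair (f v) y = z ∧ ¬ Q z) (.ex (.and
        (.pair_eq hf.init.init TermFun.last.init .last) (ih hQ .last).not))).congr fun v => ?_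
    simp [hPQ]

open Nat.Partrec (Code)

theorem primrec_unpair_fst : Primrec fun x : ℕ => x.unpair.1 := Primrec.fst.comp Primrec.unpair

theorem primrec_unpair_snd : Primrec fun x : ℕ => x.unpair.2 := Primrec.snd.comp Primrec.unpair

theorem exists_code_search {Q : ℕ → Prop} (hQ : PrimrecPred Q) :
    ∃ c : Code, ∀ x, ((∃ w, ¬ Q (Nat.pair x w)) → ∃ w, w ∈ c.eval x) ∧
      ∀ w ∈ c.eval x, ¬ Q (Nat.pair x w) := by
  obtain ⟨_, hQ⟩ := hQ
  have hp : Computable₂ fun x w : ℕ => !decide (Q (Nat.pair x w)) :=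
    (Primrec.not.comp (hQ.comp (Primrec₂.natPair.comp Primrec.fst Primrec.snd))).to_comp
  obtain ⟨c, hc⟩ := Code.exists_code.1 (Partrec.nat_iff.1 (Partrec.rfind hp.partrec₂))
  refine ⟨c, fun x => ⟨fun ⟨w, hw⟩ => ?_, fun w hw => ?_⟩⟩
  · rw [hc]
    exact Part.dom_iff_mem.1 (Nat.rfind_dom.2 ⟨w, by simpa using hw, fun _ => trivial⟩)
  · rw [hc] at hw
    simpa using Nat.rfind_spec hw

/-- A universal `Σ_{j+1}` set. -/
def univSet : ℕ → ℕ → Prop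
  | 0, p => ∃ s, ¬ Code.evaln s (Denumerable.ofNat Code p.unpair.1) p.unpair.2 = none
  | j + 1, p => ∃ y, ¬ univSet j (Nat.pair p.unpair.1 (Nat.pair p.unpair.2 y))

theorem primrec_evaln_ofNat {s e x : ℕ → ℕ} (hs : Primrec s) (he : Primrec e) (hx : Primrec x) :
    Primrec fun p => Code.evaln (s p) (Denumerable.ofNat Code (e p)) (x p) :=
  Code.primrec_evaln.comp ((hs.pair ((Primrec.ofNat Code).comp he)).pair hx)

theorem sigmaSet_univSet (j : ℕ) : SigmaSet (j + 1) (univSet j) := by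
  induction j with
  | zero =>
    refine ⟨fun p => Code.evaln p.unpair.2 (Denumerable.ofNat Code p.unpair.1.unpair.1)
      p.unpair.1.unpair.2 = none, ?_, fun x => by simp [univSet]⟩
    exact Primrec.eq.comp (primrec_evaln_ofNat primrec_unpair_snd
      (primrec_unpair_fst.comp primrec_unpair_fst)
      (primrec_unpair_snd.comp primrec_unpair_fst)) (Primrec.const none)
  | succ j ih =>
    refine ⟨_, ih.comp (f := fun p => Nat.pair p.unpair.1.unpair.1
      (Nat.pair p.unpair.1.unpair.2 p.unpair.2)) ?_, fun x => by simp [univSet]⟩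
    exact Primrec₂.natPair.comp (primrec_unpair_fst.comp primrec_unpair_fst)
      (Primrec₂.natPair.comp (primrec_unpair_snd.comp primrec_unpair_fst) primrec_unpair_snd)

theorem SigmaSet.exists_univSet_iff {j : ℕ} {P : ℕ → Prop} (hP : SigmaSet (j + 1) P) :
    ∃ e, ∀ x, P x ↔ univSet j (Nat.pair e x) := by
  induction j generalizing P with
  | zero =>
    obtain ⟨Q, hQ, hPQ⟩ := hP
    obtain ⟨c, hc⟩ := exists_code_search hQ
    refine ⟨Encodable.encode c, fun x => ?_⟩
    simp only [hPQ, univSet, Nat.unpair_pair, Denumerable.ofNat_encode,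
      Option.ne_none_iff_exists', ← Option.mem_def]
    constructor
    · intro h
      obtain ⟨w, hw⟩ := (hc x).1 h
      obtain ⟨s, hs⟩ := Code.evaln_complete.1 hw
      exact ⟨s, w, hs⟩
    · rintro ⟨s, w, hw⟩
      exact ⟨w, (hc x).2 w (Code.evaln_sound hw)⟩
  | succ j ih =>
    obtain ⟨Q, hQ, hPQ⟩ := hP
    obtain ⟨e, he⟩ := ih hQ
    exact ⟨e, fun x => by simp [hPQ, univSet, he]⟩

/-- A `Σₖ` set whose complement is universal for searches in `Σ_{k+1}` sets. -/
theorem exists_universal_search (k : ℕ) : ∃ W, SigmaSet k W ∧ ∀ A, SigmaSet (k + 1) A →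
    ∃ e, ∀ x, ((∃ y, A (Nat.pair x y)) → ∃ y, ¬ W (Nat.pair (Nat.pair e x) y)) ∧
      ∀ y, ¬ W (Nat.pair (Nat.pair e x) y) → ∃ z ≤ y, A (Nat.pair x z) := by
  have hreorder : Primrec fun p : ℕ =>
      Nat.pair (Nat.pair p.unpair.1 p.unpair.2.unpair.1) p.unpair.2.unpair.2 :=
    Primrec₂.natPair.comp (Primrec₂.natPair.comp primrec_unpair_fst
      (primrec_unpair_fst.comp primrec_unpair_snd)) (primrec_unpair_snd.comp primrec_unpair_snd)
  cases k with
  | zero =>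
    refine ⟨fun p => ¬ Code.evaln p.unpair.2.unpair.1
      (Denumerable.ofNat Code p.unpair.1.unpair.1) p.unpair.1.unpair.2 =
        some p.unpair.2.unpair.2, ?_, ?_⟩
    · exact PrimrecPred.not (Primrec.eq.comp (primrec_evaln_ofNat
        (primrec_unpair_fst.comp primrec_unpair_snd) (primrec_unpair_fst.comp primrec_unpair_fst)
        (primrec_unpair_snd.comp primrec_unpair_fst))
        (Primrec.option_some.comp (primrec_unpair_snd.comp primrec_unpair_snd)))
    · rintro A ⟨Q, hQ, hA⟩
      obtain ⟨c, hc⟩ := exists_code_search (hQ.comp hreorder)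
      refine ⟨Encodable.encode c, fun x => ?_⟩
      simp only [Nat.unpair_pair, Denumerable.ofNat_encode, not_not, ← Option.mem_def] at hc ⊢
      constructor
      · rintro ⟨y, hy⟩
        obtain ⟨z, hz⟩ := (hA _).1 hy
        obtain ⟨w, hw⟩ := (hc x).1 ⟨Nat.pair y z, by simpa using hz⟩
        obtain ⟨s, hs⟩ := Code.evaln_complete.1 hw
        exact ⟨Nat.pair s w, by simpa using hs⟩
      · intro y hy
        exact ⟨y.unpair.2.unpair.1, (Nat.unpair_left_le _).trans (Nat.unpair_right_le _),
          (hA _).2 ⟨_, (hc x).2 _ (Code.evaln_sound hy)⟩⟩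
  | succ j =>
    refine ⟨_, (sigmaSet_univSet j).comp (f := fun p => Nat.pair p.unpair.1.unpair.1
      (Nat.pair p.unpair.1.unpair.2 p.unpair.2)) ?_, ?_⟩
    · exact Primrec₂.natPair.comp (primrec_unpair_fst.comp primrec_unpair_fst)
        (Primrec₂.natPair.comp (primrec_unpair_snd.comp primrec_unpair_fst) primrec_unpair_snd)
    · rintro A ⟨Q, hQ, hA⟩
      obtain ⟨e, he⟩ := (hQ.comp hreorder).exists_univSet_iff
      refine ⟨e, fun x => ?_⟩
      simp only [Nat.unpair_pair, ← he]
      constructor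
      · rintro ⟨y, hy⟩
        obtain ⟨z, hz⟩ := (hA _).1 hy
        exact ⟨Nat.pair y z, by simpa using hz⟩
      · intro y hy
        exact ⟨y.unpair.1, Nat.unpair_left_le _, (hA _).2 ⟨_, hy⟩⟩

theorem primrec_beta {f g : ℕ → ℕ} (hf : Primrec f) (hg : Primrec g) :
    Primrec fun x => Nat.beta (f x) (g x) :=
  Primrec.nat_mod.comp (primrec_unpair_fst.comp hf) (Primrec.succ.comp
    (Primrec.nat_mul.comp (Primrec.succ.comp hg) (primrec_unpair_snd.comp hf)))

theorem beta_le (s i : ℕ) : Nat.beta s i ≤ s :=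
  (Nat.mod_le _ _).trans (Nat.unpair_left_le _)

/-- A hierarchy of bounds closed under witnesses for `Σ_{k+1}` sets, together with a set `C`
with `Σ_{k+1}` complement whose sections are nonempty and eventually exceed every bound. -/
theorem exists_bounds (k : ℕ) : ∃ (B : ℕ → ℕ → ℕ) (C : ℕ → Prop),
    (∀ i, i ≤ B 0 i) ∧ (∀ i, Monotone fun m => B m i) ∧
    (∀ m i, (B m i + 1) ^ 2 ≤ B (m + 1) i) ∧
    (∀ A, SigmaSet (k + 1) A → ∃ e, ∀ m i, e ≤ i → ∀ x ≤ B m i, (∃ y, A (Nat.pair x y)) →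
      ∃ y ≤ B (m + 1) i, A (Nat.pair x y)) ∧
    (SigmaSet (k + 1) fun p => ¬ C p) ∧ (∀ x, ∃ c, C (Nat.pair x c)) ∧
    ∀ m x, m < x → ∀ c, C (Nat.pair x c) → B m x < c := by
  obtain ⟨W, hW, hWu⟩ := exists_universal_search k
  let D : ℕ → ℕ → Prop := fun u v => (u + 1) ^ 2 ≤ v ∧ ∀ e ≤ u, ∀ x ≤ u,
    (∃ y, ¬ W (Nat.pair (Nat.pair e x) y)) → ∃ y ≤ v, ¬ W (Nat.pair (Nat.pair e x) y)
  have hDset : SigmaSet (k + 1) fun p => ¬ D p.unpair.1 p.unpair.2 := by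
    have h₁ : SigmaSet (k + 1) fun p => ¬ (p.unpair.1 + 1) ^ 2 ≤ p.unpair.2 := by
      refine (SigmaSet.of_primrecPred (Primrec.nat_le.comp (Primrec.nat_mul.comp
        (Primrec.succ.comp primrec_unpair_fst) (Primrec.succ.comp primrec_unpair_fst))
        primrec_unpair_snd).not).congr fun p => by simp [sq]
    have h₂ := ((hW.not_succ.ex).comp (Primrec₂.natPair.comp
        (primrec_unpair_snd.comp primrec_unpair_fst) primrec_unpair_snd)).and
      (((hW.succ.comp (Primrec₂.natPair.comp (primrec_unpair_fst.comp primrec_unpair_fst)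
        primrec_unpair_snd)).ball primrec_unpair_snd).comp (Primrec₂.natPair.comp
        (Primrec₂.natPair.comp (primrec_unpair_snd.comp primrec_unpair_fst) primrec_unpair_snd)
        (primrec_unpair_snd.comp (primrec_unpair_fst.comp primrec_unpair_fst))))
    refine (h₁.or ((h₂.bex (primrec_unpair_fst.comp primrec_unpair_fst)).bex
      primrec_unpair_fst)).congr fun p => ?_
    simp only [Nat.unpair_pair, D, not_and_or, not_forall, not_exists, not_not, exists_prop]
    simp only [imp_iff_not_or]
  have hDex : ∀ u, ∃ v, D u v := by
    intro u
    have : ∀ e x, ∃ b, (∃ y, ¬ W (Nat.pair (Nat.pair e x) y)) →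
        ∃ y ≤ b, ¬ W (Nat.pair (Nat.pair e x) y) := fun e x => by
      by_cases h : ∃ y, ¬ W (Nat.pair (Nat.pair e x) y)
      · obtain ⟨y, hy⟩ := h
        exact ⟨y, fun _ => ⟨y, le_rfl, hy⟩⟩
      · exact ⟨0, fun h' => absurd h' h⟩
    choose b hb using this
    refine ⟨(u + 1) ^ 2 + ∑ e ∈ Finset.range (u + 1), ∑ x ∈ Finset.range (u + 1), b e x,
      Nat.le_add_right _ _, fun e he x hx h => ?_⟩
    obtain ⟨y, hy, hyW⟩ := hb e x h
    refine ⟨y, ?_, hyW⟩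
    calc y ≤ b e x := hy
      _ ≤ ∑ x ∈ Finset.range (u + 1), b e x :=
        Finset.single_le_sum (f := fun x => b e x) (fun _ _ => Nat.zero_le _)
          (Finset.mem_range.2 (by lia))
      _ ≤ ∑ e ∈ Finset.range (u + 1), ∑ x ∈ Finset.range (u + 1), b e x :=
        Finset.single_le_sum (f := fun e => ∑ x ∈ Finset.range (u + 1), b e x)
          (fun _ _ => Nat.zero_le _) (Finset.mem_range.2 (by lia))
      _ ≤ _ := Nat.le_add_left _ _
  classical
  let E : ℕ → ℕ := fun u => Nat.find (hDex u)
  have hE : ∀ u, D u (E u) := fun u => Nat.find_spec (hDex u)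
  have hEle : ∀ {u v}, D u v → E u ≤ v := fun h => Nat.find_min' _ h
  have hElt : ∀ u, u < E u := fun u => by nlinarith [(hE u).1]
  have hEmono : Monotone E := fun u u' huu' => hEle
    ⟨(Nat.pow_le_pow_left (by lia) 2).trans (hE u').1,
      fun e he x hx => (hE u').2 e (he.trans huu') x (hx.trans huu')⟩
  have hB : ∀ i, StrictMono fun m => E^[m] i := fun i => strictMono_nat_of_lt_succ fun m => by
    rw [Function.iterate_succ_apply']
    exact hElt _
  refine ⟨fun m i => E^[m] i, fun p => Nat.beta p.unpair.2 0 = p.unpair.1 ∧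
      ∀ i ≤ p.unpair.1, D (Nat.beta p.unpair.2 i) (Nat.beta p.unpair.2 (i + 1)),
    fun i => le_rfl, fun i => (hB i).monotone, fun m i => ?_, fun A hA => ?_, ?_,
    fun x => ?_, fun m x hmx c hc => ?_⟩
  · simp only [Function.iterate_succ_apply']
    exact (hE _).1
  · obtain ⟨e, he⟩ := hWu A hA
    refine ⟨e, fun m i hi x hx hy => ?_⟩
    simp only [Function.iterate_succ_apply']
    obtain ⟨y, hy, hyW⟩ := (hE (E^[m] i)).2 e (hi.trans ((hB i).monotone (Nat.zero_le m))) x hx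
      ((he x).1 hy)
    obtain ⟨z, hz, hzA⟩ := (he x).2 y hyW
    exact ⟨z, hz.trans hy, hzA⟩
  · refine ((SigmaSet.of_primrecPred (Primrec.eq.comp (primrec_beta primrec_unpair_snd
      (Primrec.const 0)) primrec_unpair_fst).not).or ((hDset.comp (Primrec₂.natPair.comp
        (primrec_beta (primrec_unpair_snd.comp primrec_unpair_fst) primrec_unpair_snd)
        (primrec_beta (primrec_unpair_snd.comp primrec_unpair_fst)
          (Primrec.succ.comp primrec_unpair_snd)))).bex primrec_unpair_fst)).congr fun p => ?_
    simp only [Nat.unpair_pair, not_and_or, not_forall, exists_prop, Nat.succ_eq_add_one]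
  · obtain ⟨s, hs⟩ := exists_beta_eq (fun j => E^[j] x) (x + 1)
    refine ⟨s, ?_⟩
    simp only [Nat.unpair_pair]
    refine ⟨hs 0 (by lia), fun i hi => ?_⟩
    rw [hs i (by lia), hs (i + 1) (by lia), Function.iterate_succ_apply']
    exact hE _
  · simp only [Nat.unpair_pair] at hc
    have : ∀ i ≤ x, E^[i] x ≤ Nat.beta c i := by
      intro i
      induction i with
      | zero => exact fun _ => hc.1.ge
      | succ i ih =>
        intro hi
        rw [Function.iterate_succ_apply']
        exact (hEmono (ih (by lia))).trans (hEle (hc.2 i (by lia)))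
    exact (hB x hmx).trans_le ((this x le_rfl).trans (beta_le c x))

open Filter

/-- A family of bounding functions dominating the identity and closed under `y ↦ (y + 1) ^ 2`. -/
class BoundFamily (B : ℕ → ℕ → ℕ) : Prop where
  le_zero : ∀ i, i ≤ B 0 i
  mono : ∀ i, Monotone fun m => B m i
  sq_le : ∀ m i, (B m i + 1) ^ 2 ≤ B (m + 1) i

/-- The functions almost everywhere bounded by a member of the family `B`. -/
structure BddFun (B : ℕ → ℕ → ℕ) : Type where
  val : ℕ → ℕ
  bdd : ∃ m, ∀ᶠ i in (hyperfilter ℕ : Filter ℕ), val i ≤ B m i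

namespace BddFun

variable {B : ℕ → ℕ → ℕ}

/-- A function below a function in `BddFun B` is in `BddFun B`. -/
def ofLE (f : ℕ → ℕ) (g : BddFun B) (h : ∀ᶠ i in (hyperfilter ℕ : Filter ℕ), f i ≤ g.1 i) :
    BddFun B :=
  ⟨f, g.2.imp fun _ hm => by filter_upwards [h, hm] with i using le_trans⟩

variable [BoundFamily B]

theorem exists_sq_bound (f g : BddFun B) : ∃ m, ∀ᶠ i in (hyperfilter ℕ : Filter ℕ),
    (max (f.1 i) (g.1 i) + 1) ^ 2 ≤ B m i := by
  obtain ⟨m, hm⟩ := f.2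
  obtain ⟨l, hl⟩ := g.2
  refine ⟨max m l + 1, ?_⟩
  filter_upwards [hm, hl] with i hi hi'
  refine le_trans (Nat.pow_le_pow_left (Nat.succ_le_succ (max_le ?_ ?_)) 2)
    (BoundFamily.sq_le (max m l) i)
  · exact hi.trans (BoundFamily.mono i (le_max_left m l))
  · exact hi'.trans (BoundFamily.mono i (le_max_right m l))

/-- Closure of `BddFun B` under binary operations bounded by `(max x y + 1) ^ 2`. -/
def map₂ (op : ℕ → ℕ → ℕ) (hop : ∀ x y, op x y ≤ (max x y + 1) ^ 2) (f g : BddFun B) :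
    BddFun B :=
  ⟨fun i => op (f.1 i) (g.1 i), (exists_sq_bound f g).imp fun _ hm => by
    filter_upwards [hm] with i using (hop _ _).trans⟩

/-- The constant functions. -/
def const (c : ℕ) : BddFun B :=
  ⟨fun _ => c, 0, by
    filter_upwards [Nat.hyperfilter_le_atTop (eventually_ge_atTop c)] with i hi using
      le_trans hi (BoundFamily.le_zero i)⟩

/-- The identity function. -/
def ident : BddFun B := ⟨fun i => i, 0, Eventually.of_forall BoundFamily.le_zero⟩

/-- Successor of a bounded function. -/
def succ (f : BddFun B) : BddFun B :=
  map₂ (fun x _ => x + 1) (fun x y => by nlinarith [le_max_left x y]) f f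

/-- Pointwise sum. -/
def add : BddFun B → BddFun B → BddFun B :=
  map₂ (· + ·) fun x y => by nlinarith [le_max_left x y, le_max_right x y]

/-- Pointwise product. -/
def mul : BddFun B → BddFun B → BddFun B :=
  map₂ (· * ·) fun x y => by
    have := Nat.mul_le_mul (le_max_left x y) (le_max_right x y)
    lia

/-- Pointwise pairing. -/
def pair : BddFun B → BddFun B → BddFun B :=
  map₂ Nat.pair fun x y => (Nat.pair_lt_max_add_one_sq x y).le

theorem exists_encodeTuple {m : ℕ} (g : Fin m → BddFun B) :
    ∃ x : BddFun B, ∀ i, x.1 i = encodeTuple m fun j => (g j).1 i := by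
  induction m with
  | zero => exact ⟨const 0, fun _ => rfl⟩
  | succ m ih =>
    obtain ⟨x, hx⟩ := ih fun j => g j.castSucc
    exact ⟨x.pair (g (Fin.last m)), fun i => congrArg (Nat.pair · _) (hx i)⟩

end BddFun

/-- The bounded ultrapower of `ℕ` along the functions in `BddFun B`. -/
@[ext]
structure BddPower (B : ℕ → ℕ → ℕ) : Type where
  val : Germ (hyperfilter ℕ : Filter ℕ) ℕ
  exists_rep : ∃ g : BddFun B, val = g.1

namespace BddPower

variable {B : ℕ → ℕ → ℕ}

/-- The class of a bounded function in the bounded ultrapower. -/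
noncomputable def ofFun (g : BddFun B) : BddPower B := ⟨g.1, g, rfl⟩

theorem ofFun_surjective : Function.Surjective (ofFun (B := B)) :=
  fun ⟨_, g, hg⟩ => ⟨g, BddPower.ext hg.symm⟩

theorem ofFun_eq_ofFun {f g : BddFun B} :
    ofFun f = ofFun g ↔ ∀ᶠ i in (hyperfilter ℕ : Filter ℕ), f.1 i = g.1 i :=
  BddPower.ext_iff.trans Germ.coe_eq

variable {m : ℕ}

theorem snoc_ofFun (g : Fin m → BddFun B) (h : BddFun B) :
    (Fin.snoc (fun j => ofFun (g j)) (ofFun h) : Fin (m + 1) → BddPower B) =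
      fun j => ofFun ((Fin.snoc g h : Fin (m + 1) → BddFun B) j) := by
  funext j
  refine Fin.lastCases ?_ (fun j => ?_) j <;> simp

theorem snoc_val (g : Fin m → BddFun B) (h : BddFun B) (i : ℕ) :
    (fun j => ((Fin.snoc g h : Fin (m + 1) → BddFun B) j).1 i) =
      (Fin.snoc (fun j => (g j).1 i) (h.1 i) : Fin (m + 1) → ℕ) := by
  funext j
  refine Fin.lastCases ?_ (fun j => ?_) j <;> simp

variable [BoundFamily B]

noncomputable instance : LA.Structure (BddPower B) where
  funMap {_} f := match f with
    | ArithFunc.zero => fun _ => ofFun (BddFun.const 0)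
    | ArithFunc.succ => fun v =>
      ⟨(v 0).1 + 1, by obtain ⟨g, hg⟩ := (v 0).2; exact ⟨g.succ, by rw [hg]; rfl⟩⟩
    | ArithFunc.add => fun v =>
      ⟨(v 0).1 + (v 1).1, by
        obtain ⟨f, hf⟩ := (v 0).2
        obtain ⟨g, hg⟩ := (v 1).2
        exact ⟨f.add g, by rw [hf, hg]; rfl⟩⟩
    | ArithFunc.mul => fun v =>
      ⟨(v 0).1 * (v 1).1, by
        obtain ⟨f, hf⟩ := (v 0).2
        obtain ⟨g, hg⟩ := (v 1).2
        exact ⟨f.mul g, by rw [hf, hg]; rfl⟩⟩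
  RelMap {_} r := match r with
    | ArithRel.le => fun v => (v 0).1 ≤ (v 1).1

instance : Nonempty (BddPower B) := ⟨ofFun (BddFun.const 0)⟩

theorem realize_succT {α : Type} {w : α → BddPower B} {t : LA.Term α} {f : BddFun B}
    (ht : t.realize w = ofFun f) : (succT t).realize w = ofFun f.succ :=
  BddPower.ext (congrArg (· + 1) (congrArg BddPower.val ht))

theorem exists_realize_term (t : LA.Term (Empty ⊕ Fin m)) (g : Fin m → BddFun B) :
    ∃ h : BddFun B, (∀ i, h.1 i = tval t fun j => (g j).1 i) ∧
      t.realize (Sum.elim default fun j => ofFun (g j)) = ofFun h := by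
  induction t with
  | var x =>
    rcases x with x | x
    · exact x.elim
    · exact ⟨g x, fun _ => rfl, rfl⟩
  | func F ts ih =>
    cases F with
    | zero => exact ⟨BddFun.const 0, fun _ => rfl, rfl⟩
    | succ =>
      obtain ⟨h, hh, hr⟩ := ih 0
      exact ⟨h.succ, fun i => congrArg (· + 1) (hh i),
        BddPower.ext (congrArg (· + 1) (congrArg BddPower.val hr))⟩
    | add =>
      obtain ⟨h, hh, hr⟩ := ih 0
      obtain ⟨h', hh', hr'⟩ := ih 1
      exact ⟨h.add h', fun i => congrArg₂ (· + ·) (hh i) (hh' i), BddPower.ext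
        (congrArg₂ (· + ·) (congrArg BddPower.val hr) (congrArg BddPower.val hr'))⟩
    | mul =>
      obtain ⟨h, hh, hr⟩ := ih 0
      obtain ⟨h', hh', hr'⟩ := ih 1
      exact ⟨h.mul h', fun i => congrArg₂ (· * ·) (hh i) (hh' i), BddPower.ext
        (congrArg₂ (· * ·) (congrArg BddPower.val hr) (congrArg BddPower.val hr'))⟩

theorem realize_numeral (c : ℕ) (w : Empty → BddPower B) :
    (numeral c).realize w = ofFun (BddFun.const c) := by
  induction c with
  | zero => rfl
  | succ c ih => exact realize_succT ih

/-- Realization of a formula in the bounded ultrapower. -/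
abbrev Sat (φ : LA.BoundedFormula Empty m) (g : Fin m → BddFun B) : Prop :=
  φ.Realize (M := BddPower B) default fun j => ofFun (g j)

/-- Almost everywhere realization of a formula in `ℕ`. -/
abbrev AESat (φ : LA.BoundedFormula Empty m) (g : Fin m → BddFun B) : Prop :=
  ∀ᶠ i in (hyperfilter ℕ : Filter ℕ), φ.Realize default fun j => (g j).1 i

variable (B) in
/-- The formula `φ` satisfies Łoś's theorem in the bounded ultrapower. -/
def Los (φ : LA.BoundedFormula Empty m) : Prop :=
  ∀ g : Fin m → BddFun B, Sat φ g ↔ AESat φ g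

theorem sat_all {φ : LA.BoundedFormula Empty (m + 1)} {g : Fin m → BddFun B} :
    Sat φ.all g ↔ ∀ h : BddFun B, Sat φ (Fin.snoc g h : Fin (m + 1) → BddFun B) := by
  rw [Sat, realize_all, ofFun_surjective.forall]
  simp only [snoc_ofFun]

theorem sat_ex {φ : LA.BoundedFormula Empty (m + 1)} {g : Fin m → BddFun B} :
    Sat φ.ex g ↔ ∃ h : BddFun B, Sat φ (Fin.snoc g h : Fin (m + 1) → BddFun B) := by
  rw [Sat, realize_ex, ofFun_surjective.exists]
  simp only [snoc_ofFun]

theorem Los.falsum : Los B (⊥ : LA.BoundedFormula Empty m) := fun g => by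
  simp only [Sat, AESat, realize_bot, eventually_const]

theorem Los.equal (t s : LA.Term (Empty ⊕ Fin m)) : Los B (t =' s) := fun g => by
  obtain ⟨h, hh, hr⟩ := exists_realize_term t g
  obtain ⟨h', hh', hr'⟩ := exists_realize_term s g
  rw [Sat, realize_bdEqual, hr, hr', ofFun_eq_ofFun]
  exact eventually_congr (Eventually.of_forall fun i => by rw [hh, hh']; rfl)

theorem Los.le (t s : LA.Term (Empty ⊕ Fin m)) : Los B (leF t s) := fun g => by
  obtain ⟨h, hh, hr⟩ := exists_realize_term t g
  obtain ⟨h', hh', hr'⟩ := exists_realize_term s g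
  change (t.realize (Sum.elim default fun j => ofFun (g j))).1 ≤
    (s.realize (Sum.elim default fun j => ofFun (g j))).1 ↔ _
  rw [hr, hr']
  refine Germ.coe_le.trans (eventually_congr (Eventually.of_forall fun i => ?_))
  rw [hh, hh', realize_leF_nat]

theorem Los.imp {φ ψ : LA.BoundedFormula Empty m} (hφ : Los B φ) (hψ : Los B ψ) :
    Los B (φ ⟹ ψ) := fun g => by
  simp only [Sat, AESat, realize_imp]
  rw [Ultrafilter.eventually_imp]
  exact imp_congr (hφ g) (hψ g)

theorem Los.not {φ : LA.BoundedFormula Empty m} (hφ : Los B φ) : Los B (∼φ) :=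
  hφ.imp .falsum

theorem Los.inf {φ ψ : LA.BoundedFormula Empty m} (hφ : Los B φ) (hψ : Los B ψ) :
    Los B (φ ⊓ ψ) := (hφ.imp hψ.not).not

theorem Los.sup {φ ψ : LA.BoundedFormula Empty m} (hφ : Los B φ) (hψ : Los B ψ) :
    Los B (φ ⊔ ψ) := hφ.not.imp hψ

theorem Los.all {φ : LA.BoundedFormula Empty (m + 1)} (hφ : Los B φ)
    (hw : ∀ g : Fin m → BddFun B, (∀ᶠ i in (hyperfilter ℕ : Filter ℕ), ∃ y,
        ¬ φ.Realize default (Fin.snoc (fun j => (g j).1 i) y : Fin (m + 1) → ℕ)) →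
      ∃ h : BddFun B, ∀ᶠ i in (hyperfilter ℕ : Filter ℕ),
        ¬ φ.Realize default (Fin.snoc (fun j => (g j).1 i) (h.1 i) : Fin (m + 1) → ℕ)) :
    Los B φ.all := fun g => by
  rw [sat_all]
  simp only [hφ _, AESat, snoc_val, realize_all]
  constructor
  · intro H
    by_contra hcon
    rw [← Ultrafilter.eventually_not] at hcon
    obtain ⟨h, hh⟩ := hw g (hcon.mono fun i hi => not_forall.1 hi)
    exact Ultrafilter.eventually_not.1 hh (H h)
  · exact fun H h => H.mono fun i hi => hi _

theorem Los.ex {φ : LA.BoundedFormula Empty (m + 1)} (hφ : Los B φ)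
    (hw : ∀ g : Fin m → BddFun B, (∀ᶠ i in (hyperfilter ℕ : Filter ℕ), ∃ y,
        φ.Realize default (Fin.snoc (fun j => (g j).1 i) y : Fin (m + 1) → ℕ)) →
      ∃ h : BddFun B, ∀ᶠ i in (hyperfilter ℕ : Filter ℕ),
        φ.Realize default (Fin.snoc (fun j => (g j).1 i) (h.1 i) : Fin (m + 1) → ℕ)) :
    Los B φ.ex :=
  (hφ.not.all fun g => by simpa only [realize_not, not_not] using hw g).not

theorem exists_witness_of_le (t : LA.Term (Empty ⊕ Fin m)) (g : Fin m → BddFun B)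
    {R : ℕ → ℕ → Prop}
    (h : ∀ᶠ i in (hyperfilter ℕ : Filter ℕ), ∃ y ≤ tval t fun j => (g j).1 i, R i y) :
    ∃ h : BddFun B, ∀ᶠ i in (hyperfilter ℕ : Filter ℕ),
      h.1 i ≤ (tval t fun j => (g j).1 i) ∧ R i (h.1 i) := by
  obtain ⟨b, hb, -⟩ := exists_realize_term t g
  have : ∀ i, ∃ y, (∃ y ≤ tval t fun j => (g j).1 i, R i y) →
      y ≤ (tval t fun j => (g j).1 i) ∧ R i y := fun i => by
    by_cases hi : ∃ y ≤ tval t fun j => (g j).1 i, R i y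
    · obtain ⟨y, hy⟩ := hi
      exact ⟨y, fun _ => hy⟩
    · exact ⟨0, fun hi' => absurd hi' hi⟩
  choose f hf using this
  refine ⟨.ofLE f b (h.mono fun i hi => ?_), h.mono hf⟩
  rw [hb]
  exact (hf i hi).1

theorem Los.bdall (t : LA.Term (Empty ⊕ Fin m)) {φ : LA.BoundedFormula Empty (m + 1)}
    (hφ : Los B φ) : Los B (leF (&(Fin.last m)) (liftT t) ⟹ φ).all := by
  refine ((Los.le _ _).imp hφ).all fun g hg => ?_
  simp only [realize_imp, realize_leF_nat, tval, realize_liftT, Classical.not_imp,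
    Function.comp_apply, Term.realize_var, Sum.elim_inr, Fin.snoc_last] at hg ⊢
  exact exists_witness_of_le t g hg

theorem Los.bdex (t : LA.Term (Empty ⊕ Fin m)) {φ : LA.BoundedFormula Empty (m + 1)}
    (hφ : Los B φ) : Los B (leF (&(Fin.last m)) (liftT t) ⊓ φ).ex := by
  refine ((Los.le _ _).inf hφ).ex fun g hg => ?_
  simp only [realize_inf, realize_leF_nat, tval, realize_liftT,
    Function.comp_apply, Term.realize_var, Sum.elim_inr, Fin.snoc_last] at hg ⊢
  exact exists_witness_of_le t g hg

variable {k : ℕ}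

theorem _root_.GRNonRE.Delta0.los {φ : LA.BoundedFormula Empty m} (h : Delta0 φ) : Los B φ := by
  induction h with
  | falsum => exact .falsum
  | equal t s => exact .equal t s
  | le t s => exact .le t s
  | imp _ _ ih₁ ih₂ => exact ih₁.imp ih₂
  | bdall t _ ih => exact ih.bdall t

variable (B) in
/-- The functions in `BddFun B` are closed under witnesses for `Σₖ` sets. -/
def WitnessClosed (k : ℕ) : Prop :=
  ∀ A, SigmaSet k A → ∀ x : BddFun B,
    (∀ᶠ i in (hyperfilter ℕ : Filter ℕ), ∃ y, A (Nat.pair (x.1 i) y)) →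
    ∃ h : BddFun B, ∀ᶠ i in (hyperfilter ℕ : Filter ℕ), A (Nat.pair (x.1 i) (h.1 i))

theorem WitnessClosed.exists_tuple (hB : WitnessClosed B k) {R : (Fin (m + 1) → ℕ) → Prop}
    (hR : SigmaSet k fun x => R (decodeTuple (m + 1) x)) (g : Fin m → BddFun B)
    (hg : ∀ᶠ i in (hyperfilter ℕ : Filter ℕ), ∃ y,
      R (Fin.snoc (fun j => (g j).1 i) y : Fin (m + 1) → ℕ)) :
    ∃ h : BddFun B, ∀ᶠ i in (hyperfilter ℕ : Filter ℕ),
      R (Fin.snoc (fun j => (g j).1 i) (h.1 i) : Fin (m + 1) → ℕ) := by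
  obtain ⟨x, hx⟩ := BddFun.exists_encodeTuple g
  simpa only [hx, decodeTuple_pair, decodeTuple_encodeTuple] using
    hB _ hR x (by simpa only [hx, decodeTuple_pair, decodeTuple_encodeTuple] using hg)

theorem los_of_isSigma_isPi (hB : ∀ j < k, WitnessClosed B (j + 1)) :
    (∀ {n m : ℕ} {φ : LA.BoundedFormula Empty m}, IsSigma n φ → n ≤ k → Los B φ) ∧
    (∀ {n m : ℕ} {φ : LA.BoundedFormula Empty m}, IsPi n φ → n ≤ k → Los B φ) := by
  refine hierarchy_induction (S := fun n _ φ => n ≤ k → Los B φ)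
    (P := fun n _ φ => n ≤ k → Los B φ) ?_ ?_ ?_ ?_ ?_ ?_ ?_ ?_ ?_ ?_ ?_ ?_
  · exact fun h _ => h.los
  · exact fun _ ih hn => ih (by lia)
  · exact fun h ih hn => (ih hn).ex
      ((hB _ hn).exists_tuple (sigmaSet_of_isSigma_isPi.1 h))
  · exact fun ih₁ ih₂ hn => (ih₁ hn).inf (ih₂ hn)
  · exact fun ih₁ ih₂ hn => (ih₁ hn).sup (ih₂ hn)
  · exact fun t _ ih hn => (ih hn).bdall t
  · exact fun h _ => h.los
  · exact fun _ ih hn => ih (by lia)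
  · exact fun {n m φ} h ih hn => (ih hn).all
      ((hB _ hn).exists_tuple (R := fun v => ¬ φ.Realize default v)
        (sigmaSet_of_isSigma_isPi.2 h))
  · exact fun ih₁ ih₂ hn => (ih₁ hn).inf (ih₂ hn)
  · exact fun ih₁ ih₂ hn => (ih₁ hn).sup (ih₂ hn)
  · exact fun t _ ih hn => (ih hn).bdex t

/-- At the level above the one of witness closure, `Σ`-formulas transfer from the bounded
ultrapower to `ℕ` and `Π`-formulas transfer from `ℕ` to the bounded ultrapower. -/
theorem transfer (hB : ∀ j < k, WitnessClosed B (j + 1)) :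
    (∀ {n m : ℕ} {φ : LA.BoundedFormula Empty m}, IsSigma n φ → n ≤ k + 1 →
      ∀ g : Fin m → BddFun B, Sat φ g → AESat φ g) ∧
    (∀ {n m : ℕ} {φ : LA.BoundedFormula Empty m}, IsPi n φ → n ≤ k + 1 →
      ∀ g : Fin m → BddFun B, AESat φ g → Sat φ g) := by
  have hlos := los_of_isSigma_isPi hB
  refine hierarchy_induction
    (S := fun n m φ => n ≤ k + 1 → ∀ g : Fin m → BddFun B, Sat φ g → AESat φ g)
    (P := fun n m φ => n ≤ k + 1 → ∀ g : Fin m → BddFun B, AESat φ g → Sat φ g)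
    ?_ ?_ ?_ ?_ ?_ ?_ ?_ ?_ ?_ ?_ ?_ ?_
  · exact fun h _ g => (h.los g).1
  · exact fun h _ hn g => (hlos.2 h (by lia) g).1
  · intro n m φ _ ih hn g hg
    obtain ⟨h, hh⟩ := sat_ex.1 hg
    refine (ih hn _ hh).mono fun i hi => ?_
    rw [snoc_val] at hi
    exact realize_ex.2 ⟨_, hi⟩
  · intro n m φ ψ ih₁ ih₂ hn g hg
    have hg := realize_inf.1 hg
    filter_upwards [ih₁ hn g hg.1, ih₂ hn g hg.2] with i h₁ h₂ using realize_inf.2 ⟨h₁, h₂⟩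
  · intro n m φ ψ ih₁ ih₂ hn g hg
    rcases realize_sup.1 hg with h | h
    · exact (ih₁ hn g h).mono fun i hi => realize_sup.2 (.inl hi)
    · exact (ih₂ hn g h).mono fun i hi => realize_sup.2 (.inr hi)
  · intro n m t φ ih hn g hg
    by_contra hcon
    rw [AESat, ← Ultrafilter.eventually_not] at hcon
    simp only [realize_bdall_nat, not_forall, exists_prop] at hcon
    obtain ⟨h, hh⟩ := exists_witness_of_le t g hcon
    have hsat := realize_imp.1 (sat_all.1 hg h) ((Los.le _ _ _).2 ?_)
    · have := (ih hn _ hsat).and hh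
      simp only [snoc_val] at this
      exact this.exists.elim fun i hi => hi.2.2 hi.1
    · refine hh.mono fun i hi => ?_
      rw [snoc_val, realize_leF_nat, tval, tval, realize_liftT]
      simpa only [Function.comp_apply, Term.realize_var, Sum.elim_inr, Fin.snoc_last] using hi.1
  · exact fun h _ g => (h.los g).2
  · exact fun h _ hn g => (hlos.1 h (by lia) g).2
  · intro n m φ _ ih hn g hg
    refine sat_all.2 fun h => ih hn _ (hg.mono fun i hi => ?_)
    rw [snoc_val]
    exact realize_all.1 hi _
  · intro n m φ ψ ih₁ ih₂ hn g hg
    exact realize_inf.2 ⟨ih₁ hn g (hg.mono fun i hi => (realize_inf.1 hi).1),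
      ih₂ hn g (hg.mono fun i hi => (realize_inf.1 hi).2)⟩
  · intro n m φ ψ ih₁ ih₂ hn g hg
    simp only [AESat, realize_sup] at hg
    exact realize_sup.2 ((Ultrafilter.eventually_or.1 hg).imp (ih₁ hn g) (ih₂ hn g))
  · intro n m t φ ih hn g hg
    simp only [AESat, realize_bdex_nat] at hg
    obtain ⟨h, hh⟩ := exists_witness_of_le t g hg
    refine sat_ex.2 ⟨h, realize_inf.2 ⟨(Los.le _ _ _).2 ?_, ih hn _ ?_⟩⟩
    · refine hh.mono fun i hi => ?_
      rw [snoc_val, realize_leF_nat, tval, tval, realize_liftT]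
      simpa only [Function.comp_apply, Term.realize_var, Sum.elim_inr, Fin.snoc_last] using hi.1
    · refine hh.mono fun i hi => ?_
      rw [snoc_val]
      exact hi.2

theorem Los.realize {φ : LA.BoundedFormula Empty m} (hφ : Los B φ)
    (h : ∀ v : Fin m → ℕ, φ.Realize default v) (v : Fin m → BddPower B) :
    φ.Realize default v := by
  choose g hg using fun j => ofFun_surjective (v j)
  rw [← funext hg]
  exact (hφ g).2 (Eventually.of_forall fun i => h _)

theorem models_QTheory : BddPower B ⊨ QTheory := by
  refine ⟨fun φ hφ => ?_⟩
  rcases hφ with rfl | rfl | rfl | rfl | rfl | rfl | rfl | rfl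
  · refine fun x => Los.realize (Los.equal _ _).not (fun v => ?_) _
    exact Nat.succ_ne_zero (v 0)
  · refine fun x y => Los.realize ((Los.equal _ _).imp (Los.equal _ _)) (fun v => ?_) _
    exact Nat.succ.inj
  · refine fun x => Los.realize ((Los.equal _ _).not.imp (Los.ex (Los.equal _ _) fun g hg => ?_))
      (fun v => realize_imp.2 fun hv => realize_ex.2 ⟨v 0 - 1, ?_⟩) _
    · refine ⟨.ofLE (fun i => (g 0).1 i - 1) (g 0) (Eventually.of_forall fun i => Nat.sub_le _ _),
        hg.mono fun i ⟨y, hy⟩ => ?_⟩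
      change (g 0).1 i = y + 1 at hy
      change (g 0).1 i = (g 0).1 i - 1 + 1
      lia
    · change ¬ v 0 = 0 at hv
      change v 0 = v 0 - 1 + 1
      lia
  · refine fun x => Los.realize (Los.equal _ _) (fun v => ?_) _
    exact Nat.add_zero (v 0)
  · refine fun x y => Los.realize (Los.equal _ _) (fun v => ?_) _
    exact Nat.add_succ (v 0) (v 1)
  · refine fun x => Los.realize (Los.equal _ _) (fun v => ?_) _
    exact Nat.mul_zero (v 0)
  · refine fun x y => Los.realize (Los.equal _ _) (fun v => ?_) _
    exact Nat.mul_succ (v 0) (v 1)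
  · refine realize_alls.2 fun w => Los.realize ?_ (fun v => ?_) _
    · have hex : Los B (∃' (addT (&2) (&0) =' (&1)) : LA.BoundedFormula Empty 2) := by
        refine Los.ex (Los.equal _ _) fun g hg => ?_
        refine ⟨.ofLE (fun i => (g 1).1 i - (g 0).1 i) (g 1)
          (Eventually.of_forall fun i => Nat.sub_le _ _), hg.mono fun i ⟨y, hy⟩ => ?_⟩
        change y + (g 0).1 i = (g 1).1 i at hy
        change (g 1).1 i - (g 0).1 i + (g 0).1 i = (g 1).1 i
        lia
      exact ((Los.le _ _).imp hex).inf (hex.imp (Los.le _ _))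
    · refine realize_iff.2 (Iff.trans ?_ realize_ex.symm)
      change v 0 ≤ v 1 ↔ ∃ z, z + v 0 = v 1
      exact ⟨fun h => ⟨v 1 - v 0, by lia⟩, fun ⟨z, hz⟩ => by lia⟩

end BddPower

/-- The conclusion for `Πₙ` and `Σₙ` from a single model of `Q`. -/
theorem exists_theory_of_model {n : ℕ} (M : Type) [LA.Structure M] [Nonempty M]
    (hQ : M ⊨ QTheory) (hPi : ∀ φ : LA.Sentence, IsPi n φ → ℕ ⊨ φ → M ⊨ φ)
    (hSigma : ∀ φ : LA.Sentence, IsSigma n φ → M ⊨ φ → ℕ ⊨ φ)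
    {δ : LA.BoundedFormula Empty 1} (hδ : IsPi n δ)
    (hex : ∃ x : M, δ.Realize default ![x])
    (hnum : ∀ k : ℕ, ¬ δ.Realize (M := M) default ![(numeral k).realize default]) :
    ∃ S : LA.Theory, ExtendsQ S ∧
      (∀ φ : LA.Sentence, IsPi n φ → ℕ ⊨ φ → Proves S φ) ∧
      SigmaSound n S ∧
      ∃ δ : LA.BoundedFormula Empty 1, IsPi n δ ∧
        Proves S δ.ex ∧ ∀ k : ℕ, Proves S (∼(subst1 δ k)) := by
  have key : ∀ φ : LA.Sentence, Proves (LA.completeTheory M) φ ↔ M ⊨ φ := fun φ =>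
    ⟨fun h => h.realize_sentence M, fun h => Theory.models_sentence_of_mem h⟩
  refine ⟨LA.completeTheory M, fun φ hφ => (key φ).2 (hQ.realize_of_mem φ hφ),
    fun φ h hN => (key φ).2 (hPi φ h hN), fun φ h hS => hSigma φ h ((key φ).1 hS),
    δ, hδ, (key _).2 ?_, fun k => (key _).2 ?_⟩
  · obtain ⟨x, hx⟩ := hex
    refine realize_ex.2 ⟨x, ?_⟩
    convert hx using 1
    funext i
    fin_cases i
    rfl
  · refine fun h => hnum k ?_
    have h := realize_toFormula δ _ |>.1 (realize_subst.1 h)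
    convert h using 1
    funext i
    fin_cases i
    rfl

theorem models_sentence_iff {M : Type} [LA.Structure M] (φ : LA.Sentence) (e : Empty → M)
    (v : Fin 0 → M) : M ⊨ φ ↔ BoundedFormula.Realize φ e v := by
  rw [Subsingleton.elim e default, Subsingleton.elim v default]
  exact Iff.rfl

open BddPower in
theorem exists_theory_of_bounds {k : ℕ} {B : ℕ → ℕ → ℕ} [BoundFamily B]
    (hB : ∀ j < k, WitnessClosed B (j + 1)) {C : ℕ → ℕ → Prop}
    (hC : SigmaRel k fun v : Fin 2 → ℕ => ¬ C (v 0) (v 1)) (hex : ∀ x, ∃ c, C x c)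
    (hgrow : ∀ m, ∀ᶠ x in atTop, ∀ c, C x c → B m x < c) :
    ∃ S : LA.Theory, ExtendsQ S ∧
      (∀ φ : LA.Sentence, IsPi (k + 1) φ → ℕ ⊨ φ → Proves S φ) ∧
      SigmaSound (k + 1) S ∧
      ∃ δ : LA.BoundedFormula Empty 1, IsPi (k + 1) δ ∧
        Proves S δ.ex ∧ ∀ k : ℕ, Proves S (∼(subst1 δ k)) := by
  obtain ⟨θ, hθ, hθC⟩ := hC
  have hlos : Los B θ := (los_of_isSigma_isPi hB).1 hθ le_rfl
  have hvec : ∀ f : BddFun B, (![ofFun f] : Fin 1 → BddPower B) = fun j => ofFun (![f] j) :=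
    fun f => by funext j; fin_cases j; rfl
  have hall : ∀ f : BddFun B, θ.all.Realize default ![ofFun f] ↔ ∀ h : BddFun B,
      ∀ᶠ i in (hyperfilter ℕ : Filter ℕ), ¬ C (f.1 i) (h.1 i) := fun f => by
    rw [hvec]
    refine sat_all.trans (forall_congr' fun h => ?_)
    rw [hlos]
    simp only [AESat, hθC]
    exact Iff.rfl
  refine exists_theory_of_model (BddPower B) models_QTheory (fun φ hφ hN => ?_) (fun φ hφ hM => ?_)
    (IsPi.all (.ofSigma hθ)) ⟨ofFun .ident, (hall _).2 fun h => ?_⟩ fun c hc => ?_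
  · exact (models_sentence_iff φ _ _).2 ((transfer hB).2 hφ le_rfl Fin.elim0
      (.of_forall fun i => (models_sentence_iff φ _ _).1 hN))
  · obtain ⟨i, hi⟩ := ((transfer hB).1 hφ le_rfl Fin.elim0
      ((models_sentence_iff φ _ _).1 hM)).exists
    exact (models_sentence_iff φ _ _).2 hi
  · obtain ⟨m, hm⟩ := h.2
    filter_upwards [hm, Nat.hyperfilter_le_atTop (hgrow m)] with i hi hi' hCi
    exact absurd (hi' _ hCi) (not_lt.2 hi)
  · rw [realize_numeral, hall] at hc
    obtain ⟨y, hy⟩ := hex c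
    exact (hc (.const y)).exists.elim fun _ h => h hy

theorem exists_theory_of_two_le (k : ℕ) : ∃ S : LA.Theory, ExtendsQ S ∧
      (∀ φ : LA.Sentence, IsPi (k + 2) φ → ℕ ⊨ φ → Proves S φ) ∧
      SigmaSound (k + 2) S ∧
      ∃ δ : LA.BoundedFormula Empty 1, IsPi (k + 2) δ ∧
        Proves S δ.ex ∧ ∀ k : ℕ, Proves S (∼(subst1 δ k)) := by
  obtain ⟨B, C, hle, hmono, hsq, hwit, hC, hex, hgrow⟩ := exists_bounds k
  have : BoundFamily B := ⟨hle, hmono, hsq⟩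
  refine exists_theory_of_bounds (k := k + 1) (B := B) (fun j hj A hA x hx => ?_)
    (C := fun x c => C (Nat.pair x c)) ?_ hex fun m => ?_
  · obtain ⟨e, he⟩ := hwit A (hA.mono hj)
    obtain ⟨m, hm⟩ := x.2
    have hex : ∀ i, ∃ y, (e ≤ i ∧ x.1 i ≤ B m i ∧ ∃ y, A (Nat.pair (x.1 i) y)) →
        y ≤ B (m + 1) i ∧ A (Nat.pair (x.1 i) y) := fun i => by
      by_cases hi : e ≤ i ∧ x.1 i ≤ B m i ∧ ∃ y, A (Nat.pair (x.1 i) y)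
      · obtain ⟨y, hy⟩ := he m i hi.1 _ hi.2.1 hi.2.2
        exact ⟨y, fun _ => hy⟩
      · exact ⟨0, fun hi' => absurd hi' hi⟩
    choose f hf using hex
    have hev : ∀ᶠ i in (hyperfilter ℕ : Filter ℕ),
        f i ≤ B (m + 1) i ∧ A (Nat.pair (x.1 i) (f i)) := by
      filter_upwards [Nat.hyperfilter_le_atTop (eventually_ge_atTop e), hm, hx] with i h₁ h₂ h₃
      exact hf i ⟨h₁, h₂, h₃⟩
    exact ⟨⟨f, m + 1, hev.mono fun _ h => h.1⟩, hev.mono fun _ h => h.2⟩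
  · refine (SigmaRel.ex (R := fun v z => Nat.pair (v 0) (v 1) = z ∧ ¬ C z) (.and
      (.pair_eq (TermFun.var 0).init (TermFun.var 1).init .last) (hC.sigmaRel .last))).congr
      fun v => by simp
  · filter_upwards [eventually_gt_atTop m] with x hx using hgrow m x hx

section LevelOne

variable {m : ℕ} {R R' : (Fin m → ℕ) → Prop}

theorem SigmaRel.imp_zero (hR : SigmaRel 0 R) (hR' : SigmaRel 0 R') :
    SigmaRel 0 fun v => R v → R' v := by
  obtain ⟨φ, ⟨hφ⟩, H⟩ := hR
  obtain ⟨ψ, ⟨hψ⟩, H'⟩ := hR'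
  exact ⟨φ ⟹ ψ, .ofDelta0 (.imp hφ hψ), fun v => by rw [realize_imp, H, H']⟩

theorem SigmaRel.not_zero (hR : SigmaRel 0 R) : SigmaRel 0 fun v => ¬ R v :=
  hR.imp_zero ⟨⊥, .ofDelta0 .falsum, fun _ => Iff.rfl⟩

theorem SigmaRel.ball_zero {f : (Fin m → ℕ) → ℕ} {R : (Fin m → ℕ) → ℕ → Prop} (hf : TermFun f)
    (hR : SigmaRel 0 fun w : Fin (m + 1) → ℕ => R (Fin.init w) (w (Fin.last m))) :
    SigmaRel 0 fun v => ∀ y ≤ f v, R v y := by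
  obtain ⟨φ, ⟨hφ⟩, H⟩ := hR
  obtain ⟨t, ht⟩ := hf
  exact ⟨_, .ofDelta0 (.bdall t hφ), fun v => by
    rw [realize_bdall_nat]; simp [H, ht, -Pi.default_def]⟩

/-- The nonzero common multiples of `1, …, x` eventually exceed every power of `x + 2`. -/
theorem eventually_pow_lt_of_dvd (a : ℕ) : ∀ᶠ x in atTop, ∀ c : ℕ,
    (c ≠ 0 ∧ ∀ d ≤ x, d ≠ 0 → d ∣ c) → (x + 2) ^ a < c := by
  have hp : ∀ i, (Nat.nth Nat.Prime i).Prime := Nat.prime_nth_prime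
  set p := Nat.nth Nat.Prime
  set P := ∏ i ∈ Finset.range (a + 1), p i
  filter_upwards [eventually_gt_atTop (P * 3 ^ a)] with x hx c ⟨hc, hdvd⟩
  have hx0 : x ≠ 0 := by lia
  have hprod : ∏ i ∈ Finset.range (a + 1), p i ^ Nat.log (p i) x ∣ c := by
    refine Finset.prod_dvd_of_isRelPrime (fun i _ j _ hij => ?_) fun i _ =>
      hdvd _ (Nat.pow_log_le_self _ hx0) (pow_ne_zero _ (hp i).ne_zero)
    refine Nat.coprime_iff_isRelPrime.1 (Nat.Coprime.pow _ _ ?_)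
    exact (Nat.coprime_primes (hp i) (hp j)).2 fun h =>
      hij (Nat.nth_injective Nat.infinite_setOfPred_prime h)
  have hpow : x ^ (a + 1) ≤ P * c := by
    calc x ^ (a + 1) = ∏ i ∈ Finset.range (a + 1), x := by simp
      _ ≤ ∏ i ∈ Finset.range (a + 1), p i * p i ^ Nat.log (p i) x := by
        refine Finset.prod_le_prod' fun i _ => ?_
        rw [← pow_succ']
        exact (Nat.lt_pow_succ_log_self (hp i).one_lt x).le
      _ = P * ∏ i ∈ Finset.range (a + 1), p i ^ Nat.log (p i) x := Finset.prod_mul_distrib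
      _ ≤ P * c := Nat.mul_le_mul_left _ (Nat.le_of_dvd (Nat.pos_of_ne_zero hc) hprod)
  by_contra! hle
  have : x ^ (a + 1) ≤ P * 3 ^ a * x ^ a := by
    calc x ^ (a + 1) ≤ P * c := hpow
      _ ≤ P * (3 * x) ^ a :=
        Nat.mul_le_mul_left _ (hle.trans (Nat.pow_le_pow_left (by lia) a))
      _ = P * 3 ^ a * x ^ a := by rw [mul_pow, mul_assoc]
  rw [pow_succ'] at this
  exact absurd (Nat.le_of_mul_le_mul_right this (by positivity)) (not_le.2 hx)

theorem exists_theory_one : ∃ S : LA.Theory, ExtendsQ S ∧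
      (∀ φ : LA.Sentence, IsPi 1 φ → ℕ ⊨ φ → Proves S φ) ∧
      SigmaSound 1 S ∧
      ∃ δ : LA.BoundedFormula Empty 1, IsPi 1 δ ∧
        Proves S δ.ex ∧ ∀ k : ℕ, Proves S (∼(subst1 δ k)) := by
  have : BoundFamily fun m x => (x + 2) ^ 4 ^ m := by
    refine ⟨fun i => by simp, fun i => ?_, fun m i => ?_⟩
    · exact fun m l h => Nat.pow_le_pow_right (by lia) (Nat.pow_le_pow_right (by lia) h)
    · have h4 : 1 ≤ 4 ^ m := Nat.one_le_pow _ _ (by lia)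
      calc ((i + 2) ^ 4 ^ m + 1) ^ 2 ≤ ((i + 2) ^ 4 ^ m * (i + 2)) ^ 2 := by
            refine Nat.pow_le_pow_left ?_ 2
            nlinarith [Nat.one_le_pow (4 ^ m) (i + 2) (by lia)]
        _ = (i + 2) ^ ((4 ^ m + 1) * 2) := by rw [← pow_succ, ← pow_mul]
        _ ≤ (i + 2) ^ 4 ^ (m + 1) := Nat.pow_le_pow_right (by lia) (by rw [pow_succ]; lia)
  refine exists_theory_of_bounds (k := 0) (B := fun m x => (x + 2) ^ 4 ^ m) (by simp)
    (C := fun x c => c ≠ 0 ∧ ∀ d ≤ x, d ≠ 0 → d ∣ c) ?_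
    (fun x => ⟨x.factorial, x.factorial_ne_zero, fun d hd hd0 =>
      Nat.dvd_factorial (Nat.pos_of_ne_zero hd0) hd⟩) fun m => eventually_pow_lt_of_dvd _
  refine SigmaRel.congr (R := fun v => ¬ v 1 = 0 → ¬ ∀ d ≤ v 0, ¬ d = 0 →
    ¬ ∀ q ≤ v 1, ¬ v 1 = d * q) ?_ fun v => ?_
  · refine .imp_zero (SigmaRel.eq (.var 1) .zero).not_zero (SigmaRel.not_zero
      (.ball_zero (.var 0) (.imp_zero (SigmaRel.eq .last .zero).not_zero (SigmaRel.not_zero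
        (.ball_zero (TermFun.var 1).init (SigmaRel.not_zero (.eq (TermFun.var 1).init.init
          (TermFun.last.init.mul .last))))))))
  · rw [not_and]
    refine imp_congr_right fun _ => not_congr (forall₂_congr fun d _ =>
      imp_congr_right fun hd => ?_)
    simp only [not_forall, not_not, exists_prop]
    refine ⟨fun ⟨q, _, hq⟩ => ⟨q, hq⟩, fun ⟨q, hq⟩ => ⟨q, ?_, hq⟩⟩
    rw [hq]
    exact Nat.le_mul_of_pos_left q (Nat.pos_of_ne_zero hd)

end LevelOne

section LevelZero

noncomputable instance : LA.Structure ℕ∞ where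
  funMap {_} f := match f with
    | ArithFunc.zero => fun _ => 0
    | ArithFunc.succ => fun v => v 0 + 1
    | ArithFunc.add => fun v => v 0 + v 1
    | ArithFunc.mul => fun v => v 0 * v 1
  RelMap {_} r := match r with
    | ArithRel.le => fun v => v 0 ≤ v 1

theorem realize_term_enat {m : ℕ} (t : LA.Term (Empty ⊕ Fin m)) (v : Fin m → ℕ) :
    t.realize (Sum.elim default fun j => (v j : ℕ∞)) = tval t v := by
  induction t with
  | var x =>
    rcases x with x | x
    · exact x.elim
    · rfl
  | func F ts ih =>
    cases F with
    | zero => rfl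
    | succ => exact congrArg (· + 1) (ih 0)
    | add => exact (congrArg₂ (· + ·) (ih 0) (ih 1)).trans (Nat.cast_add _ _).symm
    | mul => exact (congrArg₂ (· * ·) (ih 0) (ih 1)).trans (Nat.cast_mul _ _).symm

theorem Delta0.realize_enat {m : ℕ} {φ : LA.BoundedFormula Empty m} (h : Delta0 φ)
    (v : Fin m → ℕ) : φ.Realize default (fun j => (v j : ℕ∞)) ↔ φ.Realize default v := by
  have hsnoc : ∀ {m : ℕ} (v : Fin m → ℕ) (y : ℕ), (Fin.snoc (fun j => (v j : ℕ∞)) (y : ℕ∞) :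
      Fin (m + 1) → ℕ∞) = fun j => (((Fin.snoc v y : Fin (m + 1) → ℕ) j : ℕ) : ℕ∞) := by
    intro m v y
    funext j
    refine Fin.lastCases ?_ (fun j => ?_) j <;> simp
  induction h with
  | falsum => exact Iff.rfl
  | equal t s =>
    rw [realize_bdEqual, realize_bdEqual, realize_term_enat, realize_term_enat, Nat.cast_inj]
  | le t s =>
    rw [realize_leF_nat, ← Nat.cast_le (α := ℕ∞), ← realize_term_enat, ← realize_term_enat]
    exact Iff.rfl
  | imp _ _ ih₁ ih₂ => exact imp_congr (ih₁ v) (ih₂ v)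
  | @bdall m t φ _ ih =>
    rw [realize_bdall_nat, realize_all]
    have hle : ∀ y : ℕ∞, (leF (&(Fin.last m)) (liftT t)).Realize default
        (Fin.snoc (fun j => (v j : ℕ∞)) y : Fin (m + 1) → ℕ∞) ↔ y ≤ (tval t v : ℕ) := fun y => by
      rw [← realize_term_enat, ← realize_liftT t (fun j => (v j : ℕ∞)) y default]
      change Fin.snoc (α := fun _ => ℕ∞) (fun j => (v j : ℕ∞)) y (Fin.last m) ≤ _ ↔ _
      rw [Fin.snoc_last]
      exact Iff.rfl
    simp only [realize_imp, hle]
    constructor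
    · intro H y hy
      have := H y (Nat.cast_le.2 hy)
      rw [hsnoc] at this
      exact (ih _).1 this
    · intro H y hy
      lift y to ℕ using ne_top_of_le_ne_top (ENat.natCast_ne_top _) hy
      rw [hsnoc]
      exact (ih _).2 (H y (Nat.cast_le.1 hy))

theorem enat_models_QTheory : ℕ∞ ⊨ QTheory := by
  refine ⟨fun φ hφ => ?_⟩
  rcases hφ with rfl | rfl | rfl | rfl | rfl | rfl | rfl | rfl
  · intro x
    change ¬ x + 1 = 0
    simp
  · intro x y
    change x + 1 = y + 1 → x = y
    exact fun h => by simpa using h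
  · intro x
    rw [realize_imp, realize_ex]
    change ¬ x = 0 → ∃ y : ℕ∞, x = y + 1
    intro hx
    exact ⟨x - 1, (tsub_add_cancel_of_le (Order.one_le_iff_ne_zero.2 hx)).symm⟩
  · intro x
    exact add_zero x
  · intro x y
    exact (add_assoc x y 1).symm
  · intro x
    exact mul_zero x
  · intro x y
    change x * (y + 1) = x * y + x
    rw [mul_add, mul_one]
  · refine realize_alls.2 fun w => realize_iff.2 (Iff.trans ?_ realize_ex.symm)
    change w 0 ≤ w 1 ↔ ∃ z, z + w 0 = w 1
    rw [le_iff_exists_add']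
    simp only [eq_comm]

theorem exists_theory_zero : ∃ S : LA.Theory, ExtendsQ S ∧
      (∀ φ : LA.Sentence, IsPi 0 φ → ℕ ⊨ φ → Proves S φ) ∧
      SigmaSound 0 S ∧
      ∃ δ : LA.BoundedFormula Empty 1, IsPi 0 δ ∧
        Proves S δ.ex ∧ ∀ k : ℕ, Proves S (∼(subst1 δ k)) := by
  have habs : ∀ φ : LA.Sentence, Delta0 φ → (ℕ∞ ⊨ φ ↔ ℕ ⊨ φ) := fun φ h => by
    exact (models_sentence_iff φ _ _).trans
      ((h.realize_enat Fin.elim0).trans (models_sentence_iff φ _ _).symm)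
  refine exists_theory_of_model ℕ∞ enat_models_QTheory 
    (fun φ h => by cases h with | ofDelta0 h => exact (habs φ h).2)
    (fun φ h => by cases h with | ofDelta0 h => exact (habs φ h).1)
    (δ := &0 =' succT (&0)) (.ofDelta0 (.equal _ _))
    ⟨⊤, ?_⟩ fun k hk => ?_
  · change (⊤ : ℕ∞) = ⊤ + 1
    simp
  · have hnum : ∀ (w : Empty → ℕ∞) (k : ℕ), (numeral k).realize w = k := by
      intro w k
      induction k with
      | zero => rfl
      | succ k ih => exact congrArg (· + 1) ih
    change (numeral k).realize (M := ℕ∞) _ = (numeral k).realize (M := ℕ∞) _ + 1 at hk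
    rw [hnum] at hk
    exact absurd hk (by norm_cast; lia)

end LevelZero

/-- **Remark 3.3.** `Σₙ`-soundness does not imply `(n+1)`-consistency: there is
a `Σₙ`-sound theory `S ⊇ Q` containing `Πₙ-Th(ℕ)` together with a formula
`δ(x) ∈ Πₙ` such that `S ⊢ ∃x δ(x)` while `S ⊢ ¬δ(k̄)` for every `k ∈ ℕ`. -/
theorem sigmaSound_not_succConsistent (n : ℕ) :
    ∃ S : LA.Theory, ExtendsQ S ∧
      (∀ φ : LA.Sentence, IsPi n φ → ℕ ⊨ φ → Proves S φ) ∧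
      SigmaSound n S ∧
      ∃ δ : LA.BoundedFormula Empty 1, IsPi n δ ∧
        Proves S δ.ex ∧ ∀ k : ℕ, Proves S (∼(subst1 δ k)) := by
  match n with
  | 0 => exact exists_theory_zero
  | 1 => exact exists_theory_one
  | k + 2 => exact exists_theory_of_two_le k

end GRNonRE
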